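/- arXiv:0801.2996 — 3 statements merged into one kernel-verified Lean document; each statement's English description precedes it below -/
import Mathlib

section
/- For every a > 0, the entire function z ↦ K_{iz}(a) has only real zeros; that is, if z is a complex number with K_{iz}(a) = ∫₀^∞ e^{−a·cosh u} · cos(z·u) du = 0, then Im z = 0. -/
open MeasureTheory Real Set

/-- Modified Bessel function of the third kind `K_w(a)` for `a > 0`:
`K_w(a) = ∫₀^∞ e^{−a·cosh u} · cosh(w·u) du`. -/
noncomputable def Kbes (a : ℝ) (w : ℂ) : ℂ :=
  ∫ u in Ioi (0:ℝ), Complex.exp (-(a:ℂ) * (Real.cosh u : ℂ)) * Complex.cosh (w * (u:ℂ))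

/-- `K_{iz}(a) = ∫₀^∞ e^{−a·cosh u} · cos(z·u) du`. -/
noncomputable def Kiz (a : ℝ) (z : ℂ) : ℂ :=
  ∫ u in Ioi (0:ℝ), Complex.exp (-(a:ℂ) * (Real.cosh u : ℂ)) * Complex.cos (z * (u:ℂ))

/-- The real-valued function `K_{ix}(a)` for real `x`. -/
noncomputable def Kre (a x : ℝ) : ℝ :=
  ∫ u in Ioi (0:ℝ), Real.exp (-a * Real.cosh u) * Real.cos (x * u)

/-- The series `∑_{k=0}^∞ ((y+1)_k)² (1−t)^k / (k!·(k+1)!) = ₂F₁(y+1,y+1;2;1−t)`. -/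
noncomputable def Sgauss (y t : ℝ) : ℝ :=
  ∑' k : ℕ, ((ascPochhammer ℝ k).eval (y + 1))^2 * (1 - t)^k /
    ((k.factorial : ℝ) * ((k+1).factorial : ℝ))

/-- `f_t(y) = y² · t^y · ₂F₁(y+1, y+1; 2; 1−t)`. -/
noncomputable def fPol (t y : ℝ) : ℝ := y^2 * t ^ y * Sgauss y t

/-- `F_{a,c}(z) = K_{i(z−ic)}(a) + K_{i(z+ic)}(a)`. -/
noncomputable def Fac (a c : ℝ) (z : ℂ) : ℂ :=
  Kbes a (Complex.I * (z - Complex.I * (c:ℂ))) + Kbes a (Complex.I * (z + Complex.I * (c:ℂ)))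

/-- Pólya's function `Ξ*(z) = 16π² ∫₀^∞ cosh(9u/2) e^{−2π cosh 2u} cos(zu) du`. -/
noncomputable def XiStar (z : ℂ) : ℂ :=
  16 * (Real.pi : ℂ)^2 * ∫ u in Ioi (0:ℝ),
    ((Real.cosh (9*u/2) * Real.exp (-(2*Real.pi) * Real.cosh (2*u)) : ℝ) : ℂ) *
      Complex.cos (z * (u:ℂ))

/-- `S(α, β; w) = ∑_{k=0}^∞ (α)_k (β)_k w^k / (k!·(k+1)!) = ₂F₁(α, β; 2; w)`. -/
noncomputable def S2gauss (α β w : ℝ) : ℝ :=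
  ∑' k : ℕ, (ascPochhammer ℝ k).eval α * (ascPochhammer ℝ k).eval β * w^k /
    ((k.factorial : ℝ) * ((k+1).factorial : ℝ))

/-- `g_{t,c}(y)`. -/
noncomputable def gPol (t c y : ℝ) : ℝ :=
  y*(y+2*c) * t ^ (y+c) * S2gauss (y+1) (y+2*c+1) (1-t)
  + y*(y-2*c) * t ^ (y-c) * S2gauss (y+1) (y-2*c+1) (1-t)
  - 2*y^2 * t ^ y * S2gauss (y+1) (y+1) (1-t)

open Filter Topology

lemma one_add_sq_half_le_cosh (u : ℝ) : 1 + u ^ 2 / 2 ≤ Real.cosh u := by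
  have h1 : Real.cosh u = 1 + 2 * Real.sinh (u / 2) ^ 2 := by
    have h := Real.cosh_two_mul (u / 2)
    rw [Real.cosh_sq, mul_div_cancel₀ u two_ne_zero] at h
    linarith
  have h2 : (u / 2) ^ 2 ≤ Real.sinh (u / 2) ^ 2 := by
    rw [sq_le_sq, Real.abs_sinh]
    exact Real.self_le_sinh_iff.2 (abs_nonneg _)
  nlinarith

lemma cosh_le_exp_of_nonneg {u : ℝ} (hu : 0 ≤ u) : Real.cosh u ≤ Real.exp u := by
  rw [Real.cosh_eq]
  have : Real.exp (-u) ≤ Real.exp u := Real.exp_le_exp.2 (by linarith)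
  linarith

lemma norm_complex_cos_le_exp_norm (w : ℂ) : ‖Complex.cos w‖ ≤ Real.exp ‖w‖ := by
  rw [Complex.cos, norm_div, Complex.norm_two]
  have h1 := Complex.norm_exp_le_exp_norm (w * Complex.I)
  have h2 := Complex.norm_exp_le_exp_norm (-w * Complex.I)
  simp only [norm_mul, norm_neg, Complex.norm_I, mul_one] at h1 h2
  linarith [norm_add_le (Complex.exp (w * Complex.I)) (Complex.exp (-w * Complex.I))]

lemma norm_complex_sin_le_exp_norm (w : ℂ) : ‖Complex.sin w‖ ≤ Real.exp ‖w‖ := by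
  rw [Complex.sin, norm_div, Complex.norm_two, norm_mul, Complex.norm_I, mul_one]
  have h1 := Complex.norm_exp_le_exp_norm (w * Complex.I)
  have h2 := Complex.norm_exp_le_exp_norm (-w * Complex.I)
  simp only [norm_mul, norm_neg, Complex.norm_I, mul_one] at h1 h2
  linarith [norm_sub_le (Complex.exp (-w * Complex.I)) (Complex.exp (w * Complex.I))]

lemma integrable_exp_mul_sub_mul_sq {b : ℝ} (hb : 0 < b) (c : ℝ) :
    Integrable fun u : ℝ => Real.exp (c * u - b * u ^ 2) := by
  have h := ((integrable_exp_neg_mul_sq hb).comp_sub_right (c / (2 * b))).const_mul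
    (Real.exp (c ^ 2 / (4 * b)))
  refine h.congr (Eventually.of_forall fun u => ?_)
  simp only
  rw [← Real.exp_add]
  congr 1
  field_simp
  ring

/-- The weight `cosh^k u · e^{−x cosh u}`. -/
noncomputable def coshWeight (k : ℕ) (x u : ℝ) : ℝ := Real.cosh u ^ k * Real.exp (-x * Real.cosh u)

lemma coshWeight_nonneg (k : ℕ) (x u : ℝ) : 0 ≤ coshWeight k x u :=
  mul_nonneg (pow_nonneg (Real.cosh_pos u).le k) (Real.exp_pos _).le

@[fun_prop]
lemma continuous_coshWeight (k : ℕ) (x : ℝ) : Continuous (coshWeight k x) := by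
  unfold coshWeight; fun_prop

lemma coshWeight_anti (k : ℕ) {x x' : ℝ} (h : x ≤ x') (u : ℝ) :
    coshWeight k x' u ≤ coshWeight k x u := by
  unfold coshWeight
  have := Real.cosh_pos u
  gcongr

lemma integrableOn_coshWeight_mul_exp (k : ℕ) {x : ℝ} (hx : 0 < x) (c : ℝ) :
    IntegrableOn (fun u => coshWeight k x u * Real.exp (c * u)) (Ioi 0) := by
  refine Integrable.mono' (integrable_exp_mul_sub_mul_sq (half_pos hx) (k + c)).integrableOn
    (by fun_prop) ?_
  filter_upwards [ae_restrict_mem measurableSet_Ioi] with u hu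
  have hu0 : (0 : ℝ) ≤ u := le_of_lt hu
  rw [Real.norm_of_nonneg (mul_nonneg (coshWeight_nonneg _ _ _) (Real.exp_pos _).le)]
  calc coshWeight k x u * Real.exp (c * u)
      ≤ Real.exp (k * u) * Real.exp (-x * Real.cosh u) * Real.exp (c * u) := by
        unfold coshWeight
        rw [Real.exp_nat_mul]
        have := (Real.cosh_pos u).le
        gcongr
        exact cosh_le_exp_of_nonneg hu0
    _ ≤ _ := by
        rw [← Real.exp_add, ← Real.exp_add]
        refine Real.exp_le_exp.2 ?_
        nlinarith [one_add_sq_half_le_cosh u]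

lemma norm_coshWeight_mul_le (k : ℕ) (x : ℝ) {u c : ℝ} {w : ℂ} (hw : ‖w‖ ≤ Real.exp (c * u)) :
    ‖(coshWeight k x u : ℂ) * w‖ ≤ coshWeight k x u * Real.exp (c * u) := by
  rw [norm_mul, Complex.norm_of_nonneg (coshWeight_nonneg k x u)]
  exact mul_le_mul_of_nonneg_left hw (coshWeight_nonneg k x u)

lemma norm_cos_mul_le (z : ℂ) {u : ℝ} (hu : 0 ≤ u) :
    ‖Complex.cos (z * u)‖ ≤ Real.exp (‖z‖ * u) := by
  simpa [abs_of_nonneg hu] using norm_complex_cos_le_exp_norm (z * u)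

lemma norm_sin_mul_le (z : ℂ) {u : ℝ} (hu : 0 ≤ u) :
    ‖Complex.sin (z * u)‖ ≤ Real.exp (‖z‖ * u) := by
  simpa [abs_of_nonneg hu] using norm_complex_sin_le_exp_norm (z * u)

lemma integrableOn_coshWeight_mul_cos (k : ℕ) {x : ℝ} (hx : 0 < x) (z : ℂ) :
    IntegrableOn (fun u : ℝ => (coshWeight k x u : ℂ) * Complex.cos (z * u)) (Ioi 0) := by
  refine Integrable.mono' (integrableOn_coshWeight_mul_exp k hx ‖z‖)
    (Continuous.aestronglyMeasurable (by fun_prop)) ?_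
  filter_upwards [ae_restrict_mem measurableSet_Ioi] with u hu
  exact norm_coshWeight_mul_le k x (norm_cos_mul_le z (le_of_lt hu))

lemma integrableOn_coshWeight_mul_sin (k : ℕ) {x : ℝ} (hx : 0 < x) (z : ℂ) :
    IntegrableOn (fun u : ℝ => (coshWeight k x u : ℂ) * Complex.sin (z * u)) (Ioi 0) := by
  refine Integrable.mono' (integrableOn_coshWeight_mul_exp k hx ‖z‖)
    (Continuous.aestronglyMeasurable (by fun_prop)) ?_
  filter_upwards [ae_restrict_mem measurableSet_Ioi] with u hu
  exact norm_coshWeight_mul_le k x (norm_sin_mul_le z (le_of_lt hu))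

/-- `∫₀^∞ cosh^k u · e^{−x cosh u} · cos(zu) du`, which is `(−1)^k` times the `k`-th derivative
of `K_{iz}` at `x`. -/
noncomputable def coshMoment (k : ℕ) (z : ℂ) (x : ℝ) : ℂ :=
  ∫ u in Ioi (0 : ℝ), (coshWeight k x u : ℂ) * Complex.cos (z * u)

lemma Kiz_eq_coshMoment (x : ℝ) (z : ℂ) : Kiz x z = coshMoment 0 z x := by
  simp [Kiz, coshMoment, coshWeight]

lemma hasDerivAt_coshMoment (k : ℕ) (z : ℂ) {x : ℝ} (hx : 0 < x) :
    HasDerivAt (coshMoment k z) (-coshMoment (k + 1) z x) x := by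
  have key := hasDerivAt_integral_of_dominated_loc_of_deriv_le (μ := volume.restrict (Ioi (0 : ℝ)))
    (F := fun (x u : ℝ) => (coshWeight k x u : ℂ) * Complex.cos (z * u))
    (F' := fun (x u : ℝ) => -((coshWeight (k + 1) x u : ℂ) * Complex.cos (z * u)))
    (bound := fun u => coshWeight (k + 1) (x / 2) u * Real.exp (‖z‖ * u))
    (x₀ := x) (Ioi_mem_nhds (half_lt_self hx))
    (Eventually.of_forall fun y => Continuous.aestronglyMeasurable (by fun_prop))
    (integrableOn_coshWeight_mul_cos k hx z)
    (Continuous.aestronglyMeasurable (by fun_prop))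
    (by
      filter_upwards [ae_restrict_mem measurableSet_Ioi] with u hu y hy
      rw [norm_neg]
      refine (norm_coshWeight_mul_le (k + 1) y (norm_cos_mul_le z (le_of_lt hu))).trans ?_
      exact mul_le_mul_of_nonneg_right (coshWeight_anti _ (le_of_lt hy) u) (Real.exp_pos _).le)
    (integrableOn_coshWeight_mul_exp (k + 1) (half_pos hx) ‖z‖)
    (by
      refine Eventually.of_forall fun u y _ => ?_
      have h : HasDerivAt (fun y => coshWeight k y u) (-coshWeight (k + 1) y u) y := by
        unfold coshWeight
        have := (((hasDerivAt_id y).neg.mul_const (Real.cosh u)).exp).const_mul (Real.cosh u ^ k)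
        refine this.congr_deriv ?_
        simp only [Pi.neg_apply, id]
        ring
      refine (h.ofReal_comp.mul_const (Complex.cos (z * u))).congr_deriv ?_
      push_cast
      ring)
  have h2 := key.2
  rw [integral_neg] at h2
  exact h2

lemma norm_coshMoment_le (k : ℕ) (z : ℂ) {a : ℝ} (ha : 0 < a) :
    ∃ C : ℝ, ∀ x, a ≤ x → ‖coshMoment k z x‖ ≤ C * Real.exp (-(x - a)) := by
  refine ⟨∫ u in Ioi (0 : ℝ), coshWeight k a u * Real.exp (‖z‖ * u), fun x hx => ?_⟩
  rw [← integral_mul_const]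
  refine norm_integral_le_of_norm_le
    ((integrableOn_coshWeight_mul_exp k ha ‖z‖).mul_const _) ?_
  filter_upwards [ae_restrict_mem measurableSet_Ioi] with u hu
  refine (norm_coshWeight_mul_le k x (norm_cos_mul_le z (le_of_lt hu))).trans ?_
  rw [mul_right_comm]
  refine mul_le_mul_of_nonneg_right ?_ (Real.exp_pos _).le
  unfold coshWeight
  rw [mul_assoc, ← Real.exp_add]
  have h0 := (Real.cosh_pos u).le
  gcongr
  nlinarith [Real.one_le_cosh u]

/-- The modified Bessel equation, from two integrations by parts. -/
lemma coshMoment_bessel_equation (z : ℂ) {x : ℝ} (hx : 0 < x) :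
    (x : ℂ) ^ 2 * coshMoment 2 z x - x * coshMoment 1 z x
      = ((x : ℂ) ^ 2 - z ^ 2) * coshMoment 0 z x := by
  set f : ℝ → ℂ := fun u => -(x : ℂ) * Real.sinh u * ((coshWeight 0 x u : ℂ) * Complex.cos (z * u))
    + z * ((coshWeight 0 x u : ℂ) * Complex.sin (z * u)) with hf
  set f' : ℝ → ℂ := fun u => (x : ℂ) ^ 2 * ((coshWeight 2 x u : ℂ) * Complex.cos (z * u))
    - x * ((coshWeight 1 x u : ℂ) * Complex.cos (z * u))
    - ((x : ℂ) ^ 2 - z ^ 2) * ((coshWeight 0 x u : ℂ) * Complex.cos (z * u)) with hf'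
  have i0 := integrableOn_coshWeight_mul_cos 0 hx z
  have i1 := integrableOn_coshWeight_mul_cos 1 hx z
  have i2 := integrableOn_coshWeight_mul_cos 2 hx z
  have hderiv : ∀ u : ℝ, HasDerivAt f (f' u) u := fun u => by
    have hE : HasDerivAt (fun u : ℝ => (coshWeight 0 x u : ℂ))
        (-(x : ℂ) * Real.sinh u * coshWeight 0 x u) u := by
      have h : HasDerivAt (coshWeight 0 x) (-x * Real.sinh u * coshWeight 0 x u) u := by
        have h := ((Real.hasDerivAt_cosh u).const_mul (-x)).exp
        have e : coshWeight 0 x = fun u => Real.exp (-x * Real.cosh u) := by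
          funext v; simp [coshWeight]
        rw [e]
        convert h using 1
        ring
      convert h.ofReal_comp using 1
      push_cast; ring
    have hzu : HasDerivAt (fun u : ℝ => z * (u : ℂ)) z u := by
      simpa using (Complex.ofRealCLM.hasDerivAt (x := u)).const_mul z
    have hc := (Complex.hasDerivAt_cos (z * u)).comp u hzu
    have hs := (Complex.hasDerivAt_sin (z * u)).comp u hzu
    have hS := (Real.hasDerivAt_sinh u).ofReal_comp.const_mul (-(x : ℂ))
    have h := (hS.mul (hE.mul hc)).add ((hE.mul hs).const_mul z)
    refine h.congr_deriv ?_
    have hsq : (Real.sinh u : ℂ) ^ 2 = (Real.cosh u : ℂ) ^ 2 - 1 := by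
      have := Real.cosh_sq u
      rw [← Complex.ofReal_pow, ← Complex.ofReal_pow, this]
      push_cast; ring
    simp only [hf', coshWeight, Pi.mul_apply, Function.comp_apply, pow_zero, pow_one, one_mul, Complex.ofReal_mul,
      Complex.ofReal_pow]
    linear_combination (x : ℂ) ^ 2 * (Real.exp (-x * Real.cosh u) : ℂ) * Complex.cos (z * u) * hsq
  have hf'i : IntegrableOn f' (Ioi 0) :=
    ((i2.const_mul _).sub (i1.const_mul _)).sub (i0.const_mul _)
  have hfi : IntegrableOn f (Ioi 0) := by
    refine Integrable.add ?_ ((integrableOn_coshWeight_mul_sin 0 hx z).const_mul z)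
    refine Integrable.mono' ((integrableOn_coshWeight_mul_exp 1 hx ‖z‖).const_mul x)
      (Continuous.aestronglyMeasurable (by fun_prop)) ?_
    filter_upwards [ae_restrict_mem measurableSet_Ioi] with u hu
    have hu0 : (0 : ℝ) ≤ u := le_of_lt hu
    have h1 := norm_coshWeight_mul_le 0 x (norm_cos_mul_le z hu0)
    have h2 : Real.sinh u ≤ Real.cosh u := (Real.sinh_lt_cosh u).le
    have h3 : 0 ≤ Real.sinh u := Real.sinh_nonneg_iff.2 hu0
    rw [norm_mul, norm_mul, norm_neg, Complex.norm_of_nonneg hx.le, Complex.norm_of_nonneg h3]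
    have e : coshWeight 1 x u = Real.cosh u * coshWeight 0 x u := by simp [coshWeight]
    rw [e, mul_assoc x, mul_assoc (Real.cosh u)]
    gcongr
  have hlim := tendsto_zero_of_hasDerivAt_of_integrableOn_Ioi (fun u _ => hderiv u) hf'i hfi
  have hintegral := integral_Ioi_of_hasDerivAt_of_tendsto
    (hderiv 0).continuousAt.continuousWithinAt (fun u _ => hderiv u) hf'i hlim
  have h0 : f 0 = 0 := by simp [hf]
  rw [h0, sub_zero] at hintegral
  have hsub := (i2.const_mul ((x : ℂ) ^ 2)).sub (i1.const_mul (x : ℂ))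
  simp only [hf'] at hintegral
  rw [integral_sub (by exact hsub) (i0.const_mul _), integral_sub (i2.const_mul _) (i1.const_mul _),
    integral_const_mul, integral_const_mul, integral_const_mul] at hintegral
  exact sub_eq_zero.1 hintegral

/-- Laplace's method: `n e^{n²} K_{iz}(n²)` tends to `∫₀^∞ e^{−v²/2} dv`. -/
lemma tendsto_scaled_coshMoment (z : ℂ) :
    Tendsto (fun n : ℕ => ((((n : ℝ) + 1) * Real.exp (((n : ℝ) + 1) ^ 2) : ℝ) : ℂ)
        * coshMoment 0 z (((n : ℝ) + 1) ^ 2)) atTop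
      (𝓝 (∫ v in Ioi (0 : ℝ), ((Real.exp (-(1 / 2) * v ^ 2) : ℝ) : ℂ))) := by
  have hintegral : ∀ n : ℕ, ((((n : ℝ) + 1) * Real.exp (((n : ℝ) + 1) ^ 2) : ℝ) : ℂ)
        * coshMoment 0 z (((n : ℝ) + 1) ^ 2)
      = ∫ v in Ioi (0 : ℝ), ((Real.exp (-2 * (((n : ℝ) + 1)
          * Real.sinh (((n : ℝ) + 1)⁻¹ * (v / 2))) ^ 2) : ℝ) : ℂ)
        * Complex.cos (z * ((((n : ℝ) + 1)⁻¹ * v : ℝ) : ℂ)) := fun n => by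
    have hn : (0 : ℝ) < (n : ℝ) + 1 := by positivity
    have h := integral_comp_mul_left_Ioi (fun u : ℝ =>
      (Real.exp (((n : ℝ) + 1) ^ 2) : ℂ) * ((coshWeight 0 (((n : ℝ) + 1) ^ 2) u : ℂ)
        * Complex.cos (z * u))) 0 (inv_pos.2 hn)
    rw [inv_inv, mul_zero, Complex.real_smul, integral_const_mul
      _ (fun u : ℝ => (coshWeight 0 (((n : ℝ) + 1) ^ 2) u : ℂ) * Complex.cos (z * u)),
      ← mul_assoc] at h
    rw [Complex.ofReal_mul]
    refine h.symm.trans (integral_congr_ae (Eventually.of_forall fun v => ?_))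
    simp only
    rw [← mul_assoc]
    congr 1
    rw [coshWeight, pow_zero, one_mul, ← Complex.ofReal_mul, ← Real.exp_add]
    congr 2
    have hc : Real.cosh (((n : ℝ) + 1)⁻¹ * v)
        = 1 + 2 * Real.sinh (((n : ℝ) + 1)⁻¹ * (v / 2)) ^ 2 := by
      have h := Real.cosh_two_mul (((n : ℝ) + 1)⁻¹ * (v / 2))
      rw [Real.cosh_sq] at h
      rw [show ((n : ℝ) + 1)⁻¹ * v = 2 * (((n : ℝ) + 1)⁻¹ * (v / 2)) by ring, h]
      ring
    rw [hc]
    ring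
  simp only [hintegral]
  refine tendsto_integral_of_dominated_convergence
    (fun v => Real.exp (‖z‖ * v - 1 / 2 * v ^ 2))
    (fun n => Continuous.aestronglyMeasurable (by fun_prop))
    (integrable_exp_mul_sub_mul_sq one_half_pos ‖z‖).integrableOn (fun n => ?_) ?_
  · filter_upwards [ae_restrict_mem measurableSet_Ioi] with v hv
    have hv0 : (0 : ℝ) ≤ v := le_of_lt hv
    have hn : (0 : ℝ) < (n : ℝ) + 1 := by positivity
    have h1 : v / 2 ≤ ((n : ℝ) + 1) * Real.sinh (((n : ℝ) + 1)⁻¹ * (v / 2)) := by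
      have : ((n : ℝ) + 1)⁻¹ * (v / 2) ≤ Real.sinh (((n : ℝ) + 1)⁻¹ * (v / 2)) :=
        Real.self_le_sinh_iff.2 (by positivity)
      calc v / 2 = ((n : ℝ) + 1) * (((n : ℝ) + 1)⁻¹ * (v / 2)) := by field_simp
        _ ≤ _ := by gcongr
    have h2 : ((n : ℝ) + 1)⁻¹ * v ≤ v :=
      mul_le_of_le_one_left hv0 (inv_le_one_of_one_le₀ (by linarith [n.cast_nonneg (α := ℝ)]))
    have h3 := norm_cos_mul_le z (u := ((n : ℝ) + 1)⁻¹ * v) (by positivity)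
    have h4 : ‖z‖ * (((n : ℝ) + 1)⁻¹ * v) ≤ ‖z‖ * v := by gcongr
    rw [norm_mul, Complex.norm_of_nonneg (Real.exp_pos _).le, sub_eq_neg_add, Real.exp_add]
    refine mul_le_mul (Real.exp_le_exp.2 ?_) (h3.trans (Real.exp_le_exp.2 h4)) (norm_nonneg _)
      (Real.exp_pos _).le
    nlinarith [pow_le_pow_left₀ (by positivity : 0 ≤ v / 2) h1 2]
  · refine Eventually.of_forall fun v => ?_
    have hinv : Tendsto (fun n : ℕ => ((n : ℝ) + 1)⁻¹) atTop (𝓝 0) := by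
      simpa using tendsto_one_div_add_atTop_nhds_zero_nat (𝕜 := ℝ)
    have hs : Tendsto (fun n : ℕ => ((n : ℝ) + 1) * Real.sinh (((n : ℝ) + 1)⁻¹ * (v / 2)))
        atTop (𝓝 (v / 2)) := by
      have hd : HasDerivAt (fun t : ℝ => Real.sinh (t * (v / 2))) (v / 2) 0 := by
        simpa using ((hasDerivAt_id (0 : ℝ)).mul_const (v / 2)).sinh
      have hne : Tendsto (fun n : ℕ => ((n : ℝ) + 1)⁻¹) atTop (𝓝[≠] 0) :=
        tendsto_nhdsWithin_iff.2 ⟨hinv, Eventually.of_forall fun n =>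
          inv_ne_zero (by positivity : (n : ℝ) + 1 ≠ 0)⟩
      simpa [Function.comp_def] using hd.tendsto_slope_zero.comp hne
    have hexp : Tendsto (fun n : ℕ => ((Real.exp (-2 * (((n : ℝ) + 1)
        * Real.sinh (((n : ℝ) + 1)⁻¹ * (v / 2))) ^ 2) : ℝ) : ℂ)) atTop
        (𝓝 ((Real.exp (-(1 / 2) * v ^ 2) : ℝ) : ℂ)) := by
      have h := (Real.continuous_exp.tendsto _).comp ((hs.pow 2).const_mul (-2))
      rw [show (-2 : ℝ) * (v / 2) ^ 2 = -(1 / 2) * v ^ 2 by ring] at h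
      exact (Complex.continuous_ofReal.tendsto _).comp h
    have hcos : Tendsto (fun n : ℕ => Complex.cos (z * ((((n : ℝ) + 1)⁻¹ * v : ℝ) : ℂ))) atTop
        (𝓝 1) := by
      have hcont : Continuous fun t : ℝ => Complex.cos (z * ((t * v : ℝ) : ℂ)) := by fun_prop
      simpa [Function.comp_def] using (hcont.tendsto 0).comp hinv
    simpa using hexp.mul hcos

lemma exists_coshMoment_ne_zero (z : ℂ) (a : ℝ) : ∃ x, a < x ∧ coshMoment 0 z x ≠ 0 := by
  by_contra! h
  have hev : ∀ᶠ n : ℕ in atTop, ((((n : ℝ) + 1) * Real.exp (((n : ℝ) + 1) ^ 2) : ℝ) : ℂ)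
        * coshMoment 0 z (((n : ℝ) + 1) ^ 2) = 0 := by
    filter_upwards [tendsto_natCast_atTop_atTop.eventually_ge_atTop a] with n hn
    rw [h _ (by nlinarith [n.cast_nonneg (α := ℝ)]), mul_zero]
  have h0 := tendsto_nhds_unique (tendsto_scaled_coshMoment z)
    (tendsto_const_nhds.congr' (hev.mono fun n hn => hn.symm))
  rw [integral_complex_ofReal, integral_gaussian_Ioi] at h0
  have : (0 : ℝ) < √(π / (1 / 2)) / 2 := by positivity
  exact this.ne' (by exact_mod_cast h0)

/-- The derivative of the Wronskian-type quantity `x · Im (y′ ȳ)` for `y = K_{iz}`. -/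
lemma hasDerivAt_mul_im_wronskian (z : ℂ) {x : ℝ} (hx : 0 < x) :
    HasDerivAt (fun x : ℝ => x * (-coshMoment 1 z x * (starRingEnd ℂ) (coshMoment 0 z x)).im)
      (-(z ^ 2).im * Complex.normSq (coshMoment 0 z x) / x) x := by
  have h0 := hasDerivAt_coshMoment 0 z hx
  have h1 := hasDerivAt_coshMoment 1 z hx
  have hc : HasDerivAt (fun x => (starRingEnd ℂ) (coshMoment 0 z x))
      ((starRingEnd ℂ) (-coshMoment 1 z x)) x := by
    simpa using h0.star
  have hm := h1.neg.mul hc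
  have him := Complex.imCLM.hasFDerivAt.comp_hasDerivAt x hm
  have h := (hasDerivAt_id x).mul him
  refine h.congr_deriv ?_
  have hode := congrArg (fun w => (w * (starRingEnd ℂ) (coshMoment 0 z x)).im)
    (coshMoment_bessel_equation z hx)
  simp only [← Complex.ofReal_pow, pow_two z] at hode
  rw [eq_div_iff hx.ne']
  simp [Complex.normSq_apply, pow_two] at hode ⊢
  linear_combination hode

lemma coshMoment_ne_zero_of_im_sq_ne_zero {z : ℂ} (hz : (z ^ 2).im ≠ 0) {a : ℝ} (ha : 0 < a) :
    coshMoment 0 z a ≠ 0 := by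
  intro h0
  set W : ℝ → ℝ := fun x =>
    x * (-coshMoment 1 z x * (starRingEnd ℂ) (coshMoment 0 z x)).im with hW
  have hWd : ∀ x, 0 < x → HasDerivAt W
      (-(z ^ 2).im * Complex.normSq (coshMoment 0 z x) / x) x :=
    fun x hx => hasDerivAt_mul_im_wronskian z hx
  have hWa : W a = 0 := by simp [hW, h0]
  have hWlim : Tendsto W atTop (𝓝 0) := by
    obtain ⟨C, hC⟩ := norm_coshMoment_le 0 z ha
    obtain ⟨D, hD⟩ := norm_coshMoment_le 1 z ha
    have hlim : Tendsto (fun x : ℝ => D * C * Real.exp (2 * a) * (x * Real.exp (-2 * x)))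
        atTop (𝓝 0) := by
      have h := Real.tendsto_pow_mul_exp_neg_atTop_nhds_zero 1
      have h2 := (h.comp (tendsto_id.const_mul_atTop two_pos)).const_mul
        (D * C * Real.exp (2 * a) / 2)
      rw [mul_zero] at h2
      refine h2.congr fun x => ?_
      simp only [Function.comp_apply, id, pow_one, neg_mul]
      ring
    refine squeeze_zero_norm' ?_ hlim
    filter_upwards [eventually_ge_atTop a] with x hx
    have hx0 : 0 < x := ha.trans_le hx
    rw [hW, norm_mul, Real.norm_of_nonneg hx0.le]
    have h1 : ‖(-coshMoment 1 z x * (starRingEnd ℂ) (coshMoment 0 z x)).im‖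
        ≤ (D * Real.exp (-(x - a))) * (C * Real.exp (-(x - a))) := by
      refine (Complex.abs_im_le_norm _).trans ?_
      rw [norm_mul, norm_neg, RCLike.norm_conj]
      exact mul_le_mul (hD x hx) (hC x hx) (norm_nonneg _) ((norm_nonneg _).trans (hD x hx))
    calc _ ≤ x * ((D * Real.exp (-(x - a))) * (C * Real.exp (-(x - a)))) := by gcongr
      _ = D * C * (x * (Real.exp (-(x - a)) * Real.exp (-(x - a)))) := by ring
      _ = D * C * (x * (Real.exp (2 * a) * Real.exp (-2 * x))) := by
        rw [← Real.exp_add, ← Real.exp_add]; ring_nf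
      _ = _ := by ring
  have hanti : AntitoneOn (fun x => (z ^ 2).im * W x) (Ici a) := by
    refine antitoneOn_of_hasDerivWithinAt_nonpos (convex_Ici a)
      (f' := fun x => (z ^ 2).im * (-(z ^ 2).im * Complex.normSq (coshMoment 0 z x) / x))
      (fun x hx => ((hWd x (ha.trans_le hx)).const_mul _).continuousAt.continuousWithinAt)
      (fun x hx => ?_) (fun x hx => ?_)
    · rw [interior_Ici] at hx
      exact ((hWd x (ha.trans hx)).const_mul _).hasDerivWithinAt
    · rw [interior_Ici] at hx
      have hx0 : 0 < x := ha.trans hx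
      have : 0 ≤ (z ^ 2).im ^ 2 * Complex.normSq (coshMoment 0 z x) / x :=
        div_nonneg (mul_nonneg (sq_nonneg _) (Complex.normSq_nonneg _)) hx0.le
      calc _ = -((z ^ 2).im ^ 2 * Complex.normSq (coshMoment 0 z x) / x) := by ring
        _ ≤ 0 := by linarith
  have hzero : ∀ x, a ≤ x → W x = 0 := fun x hx => by
    have hle : (z ^ 2).im * W x ≤ 0 := by
      simpa [hWa] using hanti self_mem_Ici hx hx
    have hge : 0 ≤ (z ^ 2).im * W x := by
      have hl := hWlim.const_mul (z ^ 2).im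
      rw [mul_zero] at hl
      refine le_of_tendsto hl ?_
      filter_upwards [eventually_ge_atTop x] with y hy
      exact hanti hx (hx.trans hy) hy
    exact (mul_eq_zero.1 (le_antisymm hle hge)).resolve_left hz
  obtain ⟨x, hax, hx⟩ := exists_coshMoment_ne_zero z a
  have hx0 : 0 < x := ha.trans hax
  have hd0 : HasDerivAt W 0 x := by
    refine (hasDerivAt_const x (0 : ℝ)).congr_of_eventuallyEq ?_
    filter_upwards [Ioi_mem_nhds hax] with y hy
    exact hzero y (le_of_lt hy)
  have heq := (hWd x hx0).unique hd0
  exact div_ne_zero (mul_ne_zero (neg_ne_zero.2 hz)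
    (fun h => hx (Complex.normSq_eq_zero.1 h))) hx0.ne' heq

lemma coshMoment_ne_zero_of_re_eq_zero {z : ℂ} (hz : z.re = 0) {a : ℝ} (ha : 0 < a) :
    coshMoment 0 z a ≠ 0 := by
  have hcos : ∀ u : ℝ, Complex.cos (z * u) = (Real.cosh (z.im * u) : ℂ) := fun u => by
    have hzI : z * u = ((z.im * u : ℝ) : ℂ) * Complex.I := by
      apply Complex.ext <;> simp [hz]
    rw [hzI, Complex.cos_mul_I, Complex.ofReal_cosh]
  have hpos : ∀ u : ℝ, 0 < coshWeight 0 a u * Real.cosh (z.im * u) := fun u =>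
    mul_pos (by simp [coshWeight, Real.exp_pos]) (Real.cosh_pos _)
  have hi := integrableOn_coshWeight_mul_cos 0 ha z
  simp only [hcos, ← Complex.ofReal_mul] at hi
  have hi' : IntegrableOn (fun u => coshWeight 0 a u * Real.cosh (z.im * u)) (Ioi 0) := by
    exact hi.re
  unfold coshMoment
  simp only [hcos, ← Complex.ofReal_mul]
  rw [integral_complex_ofReal]
  refine Complex.ofReal_ne_zero.2 (ne_of_gt ?_)
  rw [setIntegral_pos_iff_support_of_nonneg_ae
    (Eventually.of_forall fun u => (hpos u).le) hi']
  have : Function.support (fun u => coshWeight 0 a u * Real.cosh (z.im * u)) = univ :=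
    Function.support_eq_univ fun u => (hpos u).ne'
  simp [this]

/-- For every `a > 0`, the entire function `z ↦ K_{iz}(a)` has only real zeros. -/
theorem Kiz_zeros_real (a : ℝ) (ha : 0 < a) (z : ℂ) (hz : Kiz a z = 0) : z.im = 0 := by
  rw [Kiz_eq_coshMoment] at hz
  by_contra him
  by_cases hre : z.re = 0
  · exact coshMoment_ne_zero_of_re_eq_zero hre ha hz
  · refine coshMoment_ne_zero_of_im_sq_ne_zero ?_ ha hz
    have : (z ^ 2).im = 2 * (z.re * z.im) := by
      rw [pow_two, Complex.mul_im]; ring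
    rw [this]
    exact mul_ne_zero two_ne_zero (mul_ne_zero hre him)
end

section
/- For every t with 0 < t < 1 and every real y, one has y · f_t′(y) ≥ 0, where f_t′ denotes the derivative of f_t with respect to y. -/
open MeasureTheory Real Set

section PowerSeriesIdentity

open PowerSeries

/-- The formal power series of `(1 - X) ^ y`. -/
noncomputable def oneSubRpowSeries (y : ℝ) : ℝ⟦X⟧ :=
  PowerSeries.mk fun n => (-1) ^ n * Ring.choose y n

/-- The formal power series of `₂F₁(y + 1, y + 1; 2; X)`. -/
noncomputable def gaussSeries (y : ℝ) : ℝ⟦X⟧ :=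
  PowerSeries.mk fun n => ((ascPochhammer ℝ n).eval (y + 1)) ^ 2 /
    ((n.factorial : ℝ) * ((n + 1).factorial : ℝ))

theorem ringChoose_succ_mul (y : ℝ) (n : ℕ) :
    (n + 1) * Ring.choose y (n + 1) = (y - n) * Ring.choose y n := by
  have h₀ := Ring.descPochhammer_eq_factorial_smul_choose y n
  have h₁ := Ring.descPochhammer_eq_factorial_smul_choose y (n + 1)
  rw [descPochhammer_succ_right, Polynomial.smeval_mul, h₀, Nat.factorial_succ] at h₁
  have hn : (n.factorial : ℝ) ≠ 0 := by positivity
  simp only [nsmul_eq_mul, Polynomial.smeval_sub, Polynomial.smeval_X, pow_one,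
    Polynomial.smeval_natCast, pow_zero] at h₁
  push_cast at h₁
  refine mul_left_cancel₀ hn ?_
  linear_combination -h₁

theorem coeff_oneSubRpowSeries_succ (y : ℝ) (n : ℕ) :
    (n + 1) * coeff (n + 1) (oneSubRpowSeries y) = (n - y) * coeff n (oneSubRpowSeries y) := by
  simp only [oneSubRpowSeries, coeff_mk, pow_succ]
  linear_combination (-(-1 : ℝ) ^ n) * ringChoose_succ_mul y n

theorem coeff_gaussSeries_succ (y : ℝ) (n : ℕ) :
    (n + 1) * (n + 2) * coeff (n + 1) (gaussSeries y) =
      (n + (y + 1)) ^ 2 * coeff n (gaussSeries y) := by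
  have hn : (n.factorial : ℝ) ≠ 0 := by positivity
  simp only [gaussSeries, coeff_mk, ascPochhammer_succ_eval, Nat.factorial_succ]
  push_cast
  field_simp
  ring

theorem oneSubRpowSeries_ode (y : ℝ) :
    (1 - X) * d⁄dX ℝ (oneSubRpowSeries y) = -(C y * oneSubRpowSeries y) := by
  ext n
  have h := coeff_oneSubRpowSeries_succ y n
  cases n with
  | zero =>
    simp only [sub_mul, one_mul, map_sub, map_neg, coeff_derivative, coeff_zero_X_mul,
      coeff_C_mul]
    linear_combination h
  | succ n =>
    simp only [sub_mul, one_mul, map_sub, map_neg, coeff_derivative, coeff_succ_X_mul,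
      coeff_C_mul]
    push_cast at h ⊢
    linear_combination h

theorem gaussSeries_ode (y : ℝ) :
    d⁄dX ℝ (d⁄dX ℝ (X * gaussSeries y)) =
      X * d⁄dX ℝ (X * d⁄dX ℝ (gaussSeries y)) + C (2 * (y + 1)) * (X * d⁄dX ℝ (gaussSeries y)) +
        C ((y + 1) ^ 2) * gaussSeries y := by
  ext n
  have h := coeff_gaussSeries_succ y n
  cases n with
  | zero =>
    simp only [map_add, coeff_derivative, coeff_zero_X_mul, coeff_succ_X_mul, coeff_C_mul]
    push_cast at h ⊢
    linear_combination h
  | succ n =>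
    simp only [map_add, coeff_derivative, coeff_succ_X_mul, coeff_C_mul]
    push_cast at h ⊢
    linear_combination h

/-- The power series of `(1 - X) ^ y * ₂F₁(y + 1, y + 1; 2; X)`. -/
noncomputable def evenGaussSeries (y : ℝ) : ℝ⟦X⟧ :=
  oneSubRpowSeries y * gaussSeries y

theorem evenGaussSeries_ode (y : ℝ) :
    (1 - X) * d⁄dX ℝ ((1 - X) * d⁄dX ℝ (X * evenGaussSeries y)) =
      C (y ^ 2) * evenGaussSeries y := by
  have hA := oneSubRpowSeries_ode y
  have hS := gaussSeries_ode y
  have hD (T : ℝ⟦X⟧) : (1 - X) * d⁄dX ℝ (oneSubRpowSeries y * T) =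
      oneSubRpowSeries y * ((1 - X) * d⁄dX ℝ T - C y * T) := by
    simp only [Derivation.leibniz, smul_eq_mul]
    linear_combination T * hA
  rw [evenGaussSeries, mul_left_comm X, hD, hD, mul_left_comm (C (y ^ 2))]
  congr 1
  simp only [Derivation.leibniz, smul_eq_mul, map_sub, map_add, derivative_X, derivative_C,
    map_mul, map_pow, map_one, map_ofNat, Derivation.map_one_eq_zero] at hS ⊢
  linear_combination (1 - X) * hS

theorem coeff_zero_evenGaussSeries (y : ℝ) : coeff 0 (evenGaussSeries y) = 1 := by
  simp [evenGaussSeries, oneSubRpowSeries, gaussSeries, coeff_mul]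

theorem coeff_one_evenGaussSeries (y : ℝ) :
    2 * coeff 1 (evenGaussSeries y) - coeff 0 (evenGaussSeries y) =
      y ^ 2 * coeff 0 (evenGaussSeries y) := by
  have h := congrArg (coeff 0) (evenGaussSeries_ode y)
  simp only [sub_mul, one_mul, map_sub, coeff_derivative, coeff_zero_X_mul, coeff_succ_X_mul,
    coeff_C_mul] at h
  norm_num at h ⊢
  linear_combination h

theorem coeff_evenGaussSeries_succ_succ (y : ℝ) (n : ℕ) :
    (n + 2) * ((n + 3) * coeff (n + 2) (evenGaussSeries y) -
        (n + 2) * coeff (n + 1) (evenGaussSeries y)) =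
      (n + 1) * ((n + 2) * coeff (n + 1) (evenGaussSeries y) -
        (n + 1) * coeff n (evenGaussSeries y)) + y ^ 2 * coeff (n + 1) (evenGaussSeries y) := by
  have h := congrArg (coeff (n + 1)) (evenGaussSeries_ode y)
  simp only [sub_mul, one_mul, map_sub, coeff_derivative, coeff_succ_X_mul, coeff_C_mul] at h
  push_cast at h
  linear_combination h

theorem coeff_evenGaussSeries_nonneg_and_mono {y z : ℝ} (h : y ^ 2 ≤ z ^ 2) (n : ℕ) :
    0 ≤ coeff n (evenGaussSeries y) ∧
      coeff n (evenGaussSeries y) ≤ coeff n (evenGaussSeries z) := by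
  suffices H : (0 ≤ coeff n (evenGaussSeries y) ∧
      coeff n (evenGaussSeries y) ≤ coeff n (evenGaussSeries z)) ∧
      (0 ≤ (n + 2) * coeff (n + 1) (evenGaussSeries y) - (n + 1) * coeff n (evenGaussSeries y) ∧
      (n + 2) * coeff (n + 1) (evenGaussSeries y) - (n + 1) * coeff n (evenGaussSeries y) ≤
      (n + 2) * coeff (n + 1) (evenGaussSeries z) - (n + 1) * coeff n (evenGaussSeries z)) from H.1
  induction n with
  | zero =>
    have hy := coeff_one_evenGaussSeries y
    have hz := coeff_one_evenGaussSeries z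
    have hy₀ := coeff_zero_evenGaussSeries y
    have hz₀ := coeff_zero_evenGaussSeries z
    rw [hy₀] at hy
    rw [hz₀] at hz
    simp only [Nat.cast_zero, zero_add, hy₀, hz₀]
    refine ⟨⟨zero_le_one, le_rfl⟩, ?_, ?_⟩ <;> nlinarith [sq_nonneg y]
  | succ n ih =>
    obtain ⟨⟨h₀, h₁⟩, h₂, h₃⟩ := ih
    have hy := coeff_evenGaussSeries_succ_succ y n
    have hz := coeff_evenGaussSeries_succ_succ z n
    have hn : (0 : ℝ) ≤ n := n.cast_nonneg
    have p₀ : 0 ≤ coeff (n + 1) (evenGaussSeries y) := by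
      refine nonneg_of_mul_nonneg_right (a := (n + 2 : ℝ)) ?_ (by positivity)
      nlinarith
    have p₁ : coeff (n + 1) (evenGaussSeries y) ≤ coeff (n + 1) (evenGaussSeries z) := by
      refine le_of_mul_le_mul_left (a := (n + 2 : ℝ)) ?_ (by positivity)
      nlinarith
    have q : y ^ 2 * coeff (n + 1) (evenGaussSeries y) ≤
        z ^ 2 * coeff (n + 1) (evenGaussSeries z) :=
      mul_le_mul h p₁ p₀ (sq_nonneg z)
    have q₀ : 0 ≤ y ^ 2 * coeff (n + 1) (evenGaussSeries y) := by positivity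
    have r₀ := mul_nonneg (by positivity : (0 : ℝ) ≤ n + 1) h₂
    have r₁ := mul_le_mul_of_nonneg_left h₃ (by positivity : (0 : ℝ) ≤ n + 1)
    push_cast
    rw [show (n : ℝ) + 1 + 2 = n + 3 by ring, show (n : ℝ) + 1 + 1 = n + 2 by ring]
    refine ⟨⟨p₀, p₁⟩, ?_, ?_⟩
    · refine nonneg_of_mul_nonneg_right (a := (n + 2 : ℝ)) ?_ (by positivity)
      rw [hy]
      exact add_nonneg r₀ q₀
    · refine le_of_mul_le_mul_left (a := (n + 2 : ℝ)) ?_ (by positivity)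
      rw [hy, hz]
      exact add_le_add r₁ q

end PowerSeriesIdentity

section Convergence

open PowerSeries Filter Topology

theorem summable_norm_mul_pow_of_ratio_tendsto_one {a q : ℕ → ℝ} (ha : ∀ n, a (n + 1) = q n * a n)
    (hq : Tendsto q atTop (𝓝 1)) {w : ℝ} (hw₀ : 0 ≤ w) (hw₁ : w < 1) :
    Summable fun n => ‖a n * w ^ n‖ := by
  obtain ⟨r, hwr, hr⟩ := exists_between hw₁
  refine summable_of_ratio_norm_eventually_le hr ?_
  have hlim : Tendsto (fun n => |q n| * w) atTop (𝓝 w) := by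
    simpa using hq.abs.mul_const w
  filter_upwards [hlim.eventually (gt_mem_nhds hwr)] with n hn
  have key : ‖a (n + 1) * w ^ (n + 1)‖ = |q n| * w * ‖a n * w ^ n‖ := by
    rw [ha, pow_succ]
    simp only [norm_mul, Real.norm_eq_abs, abs_of_nonneg hw₀]
    ring
  rw [norm_norm, norm_norm, key]
  exact mul_le_mul_of_nonneg_right hn.le (norm_nonneg _)

theorem tendsto_natCast_add_div_natCast_add (b c : ℝ) :
    Tendsto (fun n : ℕ => ((n : ℝ) + b) / (n + c)) atTop (𝓝 1) := by
  simpa [add_comm] using tendsto_add_mul_div_add_mul_atTop_nhds b c (1 : ℝ) one_ne_zero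

theorem summable_norm_oneSubRpowSeries (y : ℝ) {w : ℝ} (hw₀ : 0 ≤ w) (hw₁ : w < 1) :
    Summable fun n => ‖coeff n (oneSubRpowSeries y) * w ^ n‖ := by
  refine summable_norm_mul_pow_of_ratio_tendsto_one (fun n => ?_)
    (tendsto_natCast_add_div_natCast_add (-y) 1) hw₀ hw₁
  have hn : (n : ℝ) + 1 ≠ 0 := by positivity
  field_simp
  linear_combination coeff_oneSubRpowSeries_succ y n

theorem summable_norm_gaussSeries (y : ℝ) {w : ℝ} (hw₀ : 0 ≤ w) (hw₁ : w < 1) :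
    Summable fun n => ‖coeff n (gaussSeries y) * w ^ n‖ := by
  have hq := (tendsto_natCast_add_div_natCast_add (y + 1) 1).mul
    (tendsto_natCast_add_div_natCast_add (y + 1) 2)
  rw [one_mul] at hq
  refine summable_norm_mul_pow_of_ratio_tendsto_one (fun n => ?_) hq hw₀ hw₁
  have hn : (n : ℝ) + 1 ≠ 0 := by positivity
  have hn' : (n : ℝ) + 2 ≠ 0 := by positivity
  field_simp
  linear_combination coeff_gaussSeries_succ y n

theorem tsum_oneSubRpowSeries (y : ℝ) {w : ℝ} (hw₀ : 0 ≤ w) (hw₁ : w < 1) :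
    ∑' n, coeff n (oneSubRpowSeries y) * w ^ n = (1 - w) ^ y := by
  have hmem : -w ∈ Metric.eball (0 : ℝ) 1 := by
    simpa [enorm_eq_nnnorm, ← NNReal.coe_lt_coe, abs_of_nonneg hw₀] using hw₁
  have h := (Real.one_add_rpow_hasFPowerSeriesOnBall_zero (a := y)).hasSum hmem
  simp only [binomialSeries_apply, List.ofFn_const, List.prod_replicate, smul_eq_mul,
    zero_add] at h
  rw [sub_eq_add_neg, ← h.tsum_eq]
  refine tsum_congr fun n => ?_
  rw [oneSubRpowSeries, coeff_mk, neg_pow w n]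
  ring

theorem tsum_gaussSeries (y t : ℝ) :
    ∑' n, coeff n (gaussSeries y) * (1 - t) ^ n = Sgauss y t := by
  refine tsum_congr fun n => ?_
  rw [gaussSeries, coeff_mk]
  ring

theorem hasSum_evenGaussSeries {t : ℝ} (ht : 0 < t) (ht1 : t < 1) (y : ℝ) :
    HasSum (fun n => coeff n (evenGaussSeries y) * (1 - t) ^ n) (t ^ y * Sgauss y t) := by
  have hw₀ : 0 ≤ 1 - t := by linarith
  have hw₁ : 1 - t < 1 := by linarith
  have hA := summable_norm_oneSubRpowSeries y hw₀ hw₁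
  have hS := summable_norm_gaussSeries y hw₀ hw₁
  have hcoeff (n : ℕ) : ∑ kl ∈ Finset.HasAntidiagonal.antidiagonal n,
      coeff kl.1 (oneSubRpowSeries y) * (1 - t) ^ kl.1 *
        (coeff kl.2 (gaussSeries y) * (1 - t) ^ kl.2) =
      coeff n (evenGaussSeries y) * (1 - t) ^ n := by
    rw [evenGaussSeries, coeff_mul, Finset.sum_mul]
    refine Finset.sum_congr rfl fun kl hkl => ?_
    rw [← Finset.HasAntidiagonal.mem_antidiagonal.mp hkl, pow_add]
    ring
  have hsum := (summable_norm_sum_mul_antidiagonal_of_summable_norm hA hS).of_norm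
  have htsum := tsum_mul_tsum_eq_tsum_sum_antidiagonal_of_summable_norm hA hS
  simp only [hcoeff] at hsum htsum
  rw [tsum_oneSubRpowSeries y hw₀ hw₁, tsum_gaussSeries, sub_sub_cancel] at htsum
  rw [htsum]
  exact hsum.hasSum

theorem fPol_le_fPol_of_sq_le_sq {t : ℝ} (ht : 0 < t) (ht1 : t < 1) {y z : ℝ}
    (h : y ^ 2 ≤ z ^ 2) : fPol t y ≤ fPol t z := by
  have hw (n : ℕ) : 0 ≤ (1 - t) ^ n := pow_nonneg (by linarith) n
  have hy := hasSum_evenGaussSeries ht ht1 y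
  have hz := hasSum_evenGaussSeries ht ht1 z
  have hcoeff := coeff_evenGaussSeries_nonneg_and_mono h
  rw [fPol, fPol, mul_assoc, mul_assoc]
  exact mul_le_mul h
    (hasSum_le (fun n => mul_le_mul_of_nonneg_right (hcoeff n).2 (hw n)) hy hz)
    (hy.nonneg fun n => mul_nonneg (hcoeff n).1 (hw n)) (sq_nonneg z)

end Convergence

/-- `y · f_t′(y) ≥ 0` for `0 < t < 1` and all real `y`. -/
theorem fPol_y_mul_deriv_nonneg (t : ℝ) (ht : 0 < t) (ht1 : t < 1) (y : ℝ) :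
    0 ≤ y * deriv (fPol t) y := by
  rcases lt_trichotomy y 0 with hy | rfl | hy
  · have hanti : AntitoneOn (fPol t) (Iio 0) := fun a ha b hb hab =>
      fPol_le_fPol_of_sq_le_sq ht ht1 (by nlinarith [mem_Iio.mp ha, mem_Iio.mp hb])
    rw [← derivWithin_of_isOpen isOpen_Iio (mem_Iio.mpr hy)]
    exact mul_nonneg_of_nonpos_of_nonpos hy.le hanti.derivWithin_nonpos
  · simp
  · have hmono : MonotoneOn (fPol t) (Ioi 0) := fun a ha b hb hab =>
      fPol_le_fPol_of_sq_le_sq ht ht1 (by nlinarith [mem_Ioi.mp ha, mem_Ioi.mp hb])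
    rw [← derivWithin_of_isOpen isOpen_Ioi (mem_Ioi.mpr hy)]
    exact mul_nonneg hy.le hmono.derivWithin_nonneg
end

section
/- For every a > 0 and every c > 0, the entire function F_{a,c}(z) = K_{i(z−ic)}(a) + K_{i(z+ic)}(a) has only real zeros; that is, if F_{a,c}(z) = 0 for a complex number z, then Im z = 0. -/
open MeasureTheory Real Set

open Filter Topology

/-- The two-sided Laplace transform of `exp (-a cosh u)`, which equals `2 K_w(a)`. -/
noncomputable def coshLaplace (a : ℝ) (w : ℂ) : ℂ :=
  ∫ u : ℝ, Complex.exp (w * u - a * Real.cosh u)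

theorem sq_div_two_le_cosh (u : ℝ) : u ^ 2 / 2 ≤ Real.cosh u := by
  have h1 : Real.cosh u = 1 + 2 * Real.sinh (u / 2) ^ 2 := by
    have := Real.cosh_two_mul (u / 2)
    have h2 := Real.cosh_sq (u / 2)
    rw [mul_div_cancel₀ u two_ne_zero] at this
    linarith
  have h3 : (u / 2) ^ 2 ≤ Real.sinh (u / 2) ^ 2 := by
    rw [sq_le_sq, Real.abs_sinh]
    exact Real.self_le_sinh_iff.2 (abs_nonneg _)
  nlinarith

theorem integrable_exp_mul_sub_cosh {a : ℝ} (ha : 0 < a) (k : ℝ) :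
    Integrable fun u : ℝ => Real.exp (k * u - a * Real.cosh u) := by
  have hg : Integrable fun u : ℝ => Real.exp (k ^ 2 / a) * Real.exp (-(a / 4) * u ^ 2) :=
    (integrable_exp_neg_mul_sq (by positivity)).const_mul _
  refine hg.mono' (by fun_prop) (ae_of_all _ fun u => ?_)
  rw [Real.norm_eq_abs, abs_of_pos (Real.exp_pos _), ← Real.exp_add]
  refine Real.exp_le_exp.2 ?_
  have h1 := mul_le_mul_of_nonneg_left (sq_div_two_le_cosh u) ha.le
  have h2 : 0 ≤ (k - a * u / 2) ^ 2 / a := by positivity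
  have h3 : (k - a * u / 2) ^ 2 / a = k ^ 2 / a - k * u + a / 4 * u ^ 2 := by
    field_simp; ring
  nlinarith

theorem abs_le_exp_add_exp_neg (u : ℝ) : |u| ≤ Real.exp u + Real.exp (-u) := by
  have h1 := Real.add_one_le_exp u
  have h2 := Real.add_one_le_exp (-u)
  have := Real.exp_pos u
  have := Real.exp_pos (-u)
  rw [abs_le]; constructor <;> linarith

theorem exp_mul_le_of_abs_sub_le {k m : ℝ} (h : |k - m| ≤ 1) (u : ℝ) :
    Real.exp (k * u) ≤ Real.exp ((m + 1) * u) + Real.exp ((m - 1) * u) := by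
  have := abs_le.1 h
  have h1 := Real.exp_pos ((m + 1) * u)
  have h2 := Real.exp_pos ((m - 1) * u)
  rcases le_total 0 u with hu | hu
  · have : Real.exp (k * u) ≤ Real.exp ((m + 1) * u) := Real.exp_le_exp.2 (by nlinarith)
    linarith
  · have : Real.exp (k * u) ≤ Real.exp ((m - 1) * u) := Real.exp_le_exp.2 (by nlinarith)
    linarith

theorem norm_cexp_mul_sub_cosh (a : ℝ) (w : ℂ) (u : ℝ) :
    ‖Complex.exp (w * u - a * Real.cosh u)‖ = Real.exp (w.re * u - a * Real.cosh u) := by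
  rw [Complex.norm_exp, ← Complex.ofReal_mul]
  simp

theorem integrable_cexp_mul_sub_cosh {a : ℝ} (ha : 0 < a) (w : ℂ) :
    Integrable fun u : ℝ => Complex.exp (w * u - a * Real.cosh u) := by
  refine (integrable_exp_mul_sub_cosh ha w.re).mono' ?_ (ae_of_all _ fun u => ?_)
  · exact Continuous.aestronglyMeasurable (by fun_prop)
  · exact (norm_cexp_mul_sub_cosh a w u).le

theorem hasDerivAt_coshLaplace {a : ℝ} (ha : 0 < a) (w : ℂ) :
    Integrable (fun u : ℝ => (u : ℂ) * Complex.exp (w * u - a * Real.cosh u)) ∧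
    HasDerivAt (coshLaplace a) (∫ u : ℝ, (u : ℂ) * Complex.exp (w * u - a * Real.cosh u)) w := by
  refine hasDerivAt_integral_of_dominated_loc_of_deriv_le
    (F := fun (w : ℂ) (u : ℝ) => Complex.exp (w * u - a * Real.cosh u))
    (F' := fun (w : ℂ) (u : ℝ) => (u : ℂ) * Complex.exp (w * u - a * Real.cosh u))
    (bound := fun u : ℝ =>
      (Real.exp ((w.re + 2) * u - a * Real.cosh u) + Real.exp (w.re * u - a * Real.cosh u)) +
      (Real.exp (w.re * u - a * Real.cosh u) + Real.exp ((w.re - 2) * u - a * Real.cosh u)))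
    (Metric.closedBall_mem_nhds w one_pos) ?_ (integrable_cexp_mul_sub_cosh ha w) ?_ ?_ ?_ ?_
  · exact Eventually.of_forall fun x => Continuous.aestronglyMeasurable (by fun_prop)
  · exact Continuous.aestronglyMeasurable (by fun_prop)
  · refine ae_of_all _ fun u x hx => ?_
    rw [norm_mul, norm_cexp_mul_sub_cosh, Complex.norm_real, Real.norm_eq_abs]
    have h1 : |x.re - w.re| ≤ 1 := by
      rw [← Complex.sub_re]
      exact (Complex.abs_re_le_norm _).trans (by simpa [dist_eq_norm] using hx)
    have h2 := mul_le_mul (abs_le_exp_add_exp_neg u) (exp_mul_le_of_abs_sub_le h1 u)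
      (Real.exp_pos _).le (by positivity)
    have h3 := mul_le_mul_of_nonneg_right h2 (Real.exp_pos (-(a * Real.cosh u))).le
    simp only [sub_eq_add_neg, add_mul, mul_add, Real.exp_add, neg_mul, one_mul] at h3 ⊢
    refine h3.trans' (by rw [mul_assoc]) |>.trans (le_of_eq ?_)
    have e2 : Real.exp (2 * u) = Real.exp u * Real.exp u := by rw [← Real.exp_add]; ring_nf
    have e3 : Real.exp (-(2 * u)) = Real.exp (-u) * Real.exp (-u) := by
      rw [← Real.exp_add]; ring_nf
    have e4 : Real.exp u * Real.exp (-u) = 1 := by rw [← Real.exp_add]; simp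
    rw [e2, e3]
    linear_combination (2 * Real.exp (w.re * u) * Real.exp (-(a * Real.cosh u))) * e4
  · exact ((integrable_exp_mul_sub_cosh ha _).add (integrable_exp_mul_sub_cosh ha _)).add
      ((integrable_exp_mul_sub_cosh ha _).add (integrable_exp_mul_sub_cosh ha _))
  · refine ae_of_all _ fun u x _ => ?_
    have h := (((hasDerivAt_id x).mul_const (u : ℂ)).sub_const (a * Real.cosh u : ℂ)).cexp
    simpa [mul_comm] using h

theorem differentiable_coshLaplace {a : ℝ} (ha : 0 < a) : Differentiable ℂ (coshLaplace a) :=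
  fun w => (hasDerivAt_coshLaplace ha w).2.differentiableAt

theorem coshLaplace_neg (a : ℝ) (w : ℂ) : coshLaplace a (-w) = coshLaplace a w := by
  unfold coshLaplace
  rw [← integral_neg_eq_self]
  simp

theorem coshLaplace_conj (a : ℝ) (w : ℂ) :
    coshLaplace a (starRingEnd ℂ w) = starRingEnd ℂ (coshLaplace a w) := by
  unfold coshLaplace
  rw [← integral_conj]
  congr 1 with u
  rw [← Complex.exp_conj]
  simp only [map_sub, map_mul, Complex.conj_ofReal]

theorem Kbes_eq_coshLaplace {a : ℝ} (ha : 0 < a) (w : ℂ) : 2 * Kbes a w = coshLaplace a w := by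
  have hi := integrable_cexp_mul_sub_cosh ha w
  have hi' := integrable_cexp_mul_sub_cosh ha (-w)
  have h1 : ∫ u in Iic (0 : ℝ), Complex.exp (w * u - a * Real.cosh u) =
      ∫ u in Ioi (0 : ℝ), Complex.exp (-w * u - a * Real.cosh u) := by
    have := integral_comp_neg_Iic (0 : ℝ)
      (fun u : ℝ => Complex.exp (-w * u - a * Real.cosh u))
    simpa using this
  have h2 : coshLaplace a w = (∫ u in Iic (0 : ℝ), Complex.exp (w * u - a * Real.cosh u)) +
      ∫ u in Ioi (0 : ℝ), Complex.exp (w * u - a * Real.cosh u) :=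
    (intervalIntegral.integral_Iic_add_Ioi hi.integrableOn hi.integrableOn).symm
  rw [h2, h1, ← integral_add hi'.integrableOn hi.integrableOn, Kbes, ← integral_const_mul]
  congr 1 with u
  rw [Complex.cosh, sub_eq_add_neg, sub_eq_add_neg, Complex.exp_add, Complex.exp_add]
  ring_nf

theorem coshLaplace_mul_conj_symm (a σ x : ℝ) :
    coshLaplace a (σ + x * Complex.I) * coshLaplace a (σ - x * Complex.I) =
      (Complex.normSq (coshLaplace a (σ + x * Complex.I)) : ℂ) := by
  rw [Complex.normSq_eq_conj_mul_self, ← coshLaplace_conj, mul_comm]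
  congr 2
  simp [sub_eq_add_neg]

theorem tendsto_coshLaplace_I_mul (a : ℝ) :
    Tendsto (fun ξ : ℝ => coshLaplace a (ξ * Complex.I)) atTop (𝓝 0) := by
  have h := Real.tendsto_integral_exp_smul_cocompact
    (fun u : ℝ => Complex.exp (-(a * Real.cosh u : ℂ)))
  have h2 : Tendsto (fun ξ : ℝ => ξ * (-(2 * π))⁻¹) atTop (cocompact ℝ) :=
    (tendsto_id.atTop_mul_const_of_neg (by simp [Real.pi_pos])).mono_right atBot_le_cocompact
  refine (h.comp h2).congr fun ξ => ?_
  simp only [Function.comp, coshLaplace]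
  congr 1 with u
  rw [Circle.smul_def, Real.fourierChar_apply, smul_eq_mul, ← Complex.exp_add]
  congr 1
  have := Real.pi_pos.ne'
  push_cast
  have : (π : ℂ) ≠ 0 := by exact_mod_cast this
  field_simp
  ring

/-- The substitution `u = p + t`, `v = p - t` in a double integral. -/
theorem integral_prod_eq_two_mul_integral_add_sub {F : ℝ → ℝ → ℂ}
    (hF : Integrable (Function.uncurry F)) :
    ∫ u, ∫ v, F u v = 2 * ∫ t, ∫ p, F (p + t) (p - t) := by
  have h0 : ∀ u, ∫ v, F u v = ∫ w, F u (w + u) := fun u =>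
    (integral_add_right_eq_self (fun v => F u v) u).symm
  have hi : Integrable (Function.uncurry fun u w => F u (w + u)) :=
    (measurePreserving_prod_add_right (volume : Measure ℝ)
      (volume : Measure ℝ)).integrable_comp_of_integrable hF
  simp_rw [h0]
  rw [integral_integral_swap hi]
  have h2 := Measure.integral_comp_mul_left (fun w => ∫ u, F u (w + u)) (-2)
  have h3 : ∀ t, ∫ u, F u (-2 * t + u) = ∫ p, F (p + t) (p - t) := fun t => by
    rw [← integral_add_right_eq_self _ t]
    congr 1 with p
    congr 1; ring
  simp_rw [h3] at h2
  rw [h2]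
  simp

/-- A Frullani-type integral on the whole line. -/
theorem frullani_exp_neg_exp_of_nonneg {c s : ℝ} (hc : 0 < c) (hs : 0 ≤ s) :
    Integrable (fun q : ℝ =>
      Real.exp (-(c * Real.exp (q - s))) - Real.exp (-(c * Real.exp (q + s)))) ∧
    ∫ q : ℝ, (Real.exp (-(c * Real.exp (q - s))) - Real.exp (-(c * Real.exp (q + s)))) =
      2 * s := by
  set φ : ℝ → ℝ := fun q => Real.exp (-(c * Real.exp q)) with hφ
  have hcont : Continuous φ := by fun_prop
  have hanti : Antitone φ := fun x y hxy => by
    simp only [hφ]; gcongr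
  have hbot : Tendsto φ atBot (𝓝 1) := by
    have := (Real.continuous_exp.tendsto _).comp ((Real.tendsto_exp_atBot.const_mul c).neg)
    simpa [hφ, Function.comp_def] using this
  have htop : Tendsto φ atTop (𝓝 0) :=
    Real.tendsto_exp_atBot.comp
      (tendsto_neg_atTop_atBot.comp (Real.tendsto_exp_atTop.const_mul_atTop hc))
  have hii : ∀ x y, IntervalIntegrable φ volume x y := fun x y => hcont.intervalIntegrable x y
  have hsq : ∀ m : ℝ, 2 * s * φ (m + s) ≤ ∫ x in (m - s)..(m + s), φ x ∧
      ∫ x in (m - s)..(m + s), φ x ≤ 2 * s * φ (m - s) := fun m => by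
    have hle : m - s ≤ m + s := by linarith
    have hl := intervalIntegral.integral_mono_on hle intervalIntegrable_const (hii _ _)
      (fun x hx => hanti hx.2)
    have hr := intervalIntegral.integral_mono_on hle (hii _ _) intervalIntegrable_const
      (fun x hx => hanti hx.1)
    rw [intervalIntegral.integral_const, smul_eq_mul] at hl hr
    constructor <;> nlinarith
  have key : ∀ N : ℝ, ∫ q in (-N)..N, (φ (q - s) - φ (q + s)) =
      (∫ x in (-N - s)..(-N + s), φ x) - ∫ x in (N - s)..(N + s), φ x := fun N => by
    rw [intervalIntegral.integral_sub (by apply Continuous.intervalIntegrable; fun_prop)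
      (by apply Continuous.intervalIntegrable; fun_prop),
      intervalIntegral.integral_comp_sub_right φ, intervalIntegral.integral_comp_add_right φ,
      intervalIntegral.integral_interval_sub_interval_comm (hii _ _) (hii _ _) (hii _ _)]
  have lim1 : Tendsto (fun N : ℝ => ∫ x in (-N - s)..(-N + s), φ x) atTop (𝓝 (2 * s)) := by
    refine tendsto_of_tendsto_of_tendsto_of_le_of_le (g := fun N => 2 * s * φ (-N + s))
      (h := fun N => 2 * s * φ (-N - s)) ?_ ?_ (fun N => (hsq (-N)).1) (fun N => (hsq (-N)).2)
    · simpa using (hbot.comp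
        (tendsto_atBot_add_const_right _ s tendsto_neg_atTop_atBot)).const_mul (2 * s)
    · simpa [sub_eq_add_neg] using (hbot.comp
        (tendsto_atBot_add_const_right _ (-s) tendsto_neg_atTop_atBot)).const_mul (2 * s)
  have lim2 : Tendsto (fun N : ℝ => ∫ x in (N - s)..(N + s), φ x) atTop (𝓝 0) := by
    refine tendsto_of_tendsto_of_tendsto_of_le_of_le (g := fun N => 2 * s * φ (N + s))
      (h := fun N => 2 * s * φ (N - s)) ?_ ?_ (fun N => (hsq N).1) (fun N => (hsq N).2)
    · simpa using (htop.comp (tendsto_atTop_add_const_right _ s tendsto_id)).const_mul (2 * s)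
    · simpa [sub_eq_add_neg] using
        (htop.comp (tendsto_atTop_add_const_right _ (-s) tendsto_id)).const_mul (2 * s)
  have lim : Tendsto (fun N : ℝ => ∫ q in (-N)..N, (φ (q - s) - φ (q + s))) atTop
      (𝓝 (2 * s)) := by
    simp_rw [key]
    simpa using lim1.sub lim2
  have hint : Integrable fun q => φ (q - s) - φ (q + s) := by
    refine integrable_of_intervalIntegral_norm_tendsto (a := fun N : ℝ => -N) (b := id)
      (2 * s) (fun N => ?_) tendsto_neg_atTop_atBot tendsto_id (lim.congr fun N => ?_)
    · exact (Continuous.integrableOn_Icc (by fun_prop)).mono_set Ioc_subset_Icc_self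
    · refine intervalIntegral.integral_congr fun q _ => ?_
      have : φ (q + s) ≤ φ (q - s) := hanti (by linarith)
      simp only [Real.norm_eq_abs]
      rw [abs_of_nonneg (by linarith)]
  exact ⟨hint, tendsto_nhds_unique
    (intervalIntegral_tendsto_integral hint tendsto_neg_atTop_atBot tendsto_id) lim⟩

theorem frullani_exp_neg_exp {c : ℝ} (hc : 0 < c) (s : ℝ) :
    Integrable (fun q : ℝ =>
      Real.exp (-(c * Real.exp (q - s))) - Real.exp (-(c * Real.exp (q + s)))) ∧
    ∫ q : ℝ, (Real.exp (-(c * Real.exp (q - s))) - Real.exp (-(c * Real.exp (q + s)))) =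
      2 * s := by
  rcases le_total 0 s with hs | hs
  · exact frullani_exp_neg_exp_of_nonneg hc hs
  · obtain ⟨h1, h2⟩ := frullani_exp_neg_exp_of_nonneg hc (neg_nonneg.2 hs)
    simp only [sub_neg_eq_add, ← sub_eq_add_neg] at h1 h2
    refine ⟨h1.neg.congr (ae_of_all _ fun q => by simp), ?_⟩
    rw [← neg_neg (∫ q : ℝ, _), ← integral_neg]
    simp only [neg_sub]
    linarith

theorem abs_sinh_le_exp_add_exp (x : ℝ) : |Real.sinh x| ≤ Real.exp x + Real.exp (-x) := by
  rw [Real.sinh_eq, abs_le]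
  have := Real.exp_pos x
  have := Real.exp_pos (-x)
  constructor <;> linarith

theorem integrable_sinh_mul_exp_neg_cosh {y : ℝ} (hy : 0 < y) (ν : ℝ) :
    Integrable fun s : ℝ => Real.sinh (ν * s) * Real.exp (-(y * Real.cosh s)) := by
  refine ((integrable_exp_mul_sub_cosh hy ν).add (integrable_exp_mul_sub_cosh hy (-ν))).mono'
    (Continuous.aestronglyMeasurable (by fun_prop)) (ae_of_all _ fun s => ?_)
  rw [norm_mul, Real.norm_eq_abs, Real.norm_eq_abs, Real.abs_exp]
  have := mul_le_mul_of_nonneg_right (abs_sinh_le_exp_add_exp (ν * s))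
    (Real.exp_pos (-(y * Real.cosh s))).le
  rw [add_mul, ← Real.exp_add, ← Real.exp_add, ← sub_eq_add_neg, ← sub_eq_add_neg] at this
  simpa using this

theorem integrable_mul_exp_mul_sub_cosh {y : ℝ} (hy : 0 < y) (ν : ℝ) :
    Integrable fun s : ℝ => s * Real.exp (ν * s - y * Real.cosh s) := by
  refine ((integrable_exp_mul_sub_cosh hy (ν + 1)).add
    (integrable_exp_mul_sub_cosh hy (ν - 1))).mono'
    (Continuous.aestronglyMeasurable (by fun_prop)) (ae_of_all _ fun s => ?_)
  rw [norm_mul, Real.norm_eq_abs, Real.norm_eq_abs, Real.abs_exp]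
  have := mul_le_mul_of_nonneg_right (abs_le_exp_add_exp_neg s)
    (Real.exp_pos (ν * s - y * Real.cosh s)).le
  rw [add_mul, ← Real.exp_add, ← Real.exp_add] at this
  refine this.trans (le_of_eq ?_)
  simp only [Pi.add_apply]
  ring_nf

theorem integral_mul_exp_eq_integral_mul_sinh {y : ℝ} (hy : 0 < y) (ν : ℝ) :
    Integrable (fun p : ℝ => p * (Real.sinh (ν * p) * Real.exp (-(y * Real.cosh p)))) ∧
    ∫ p : ℝ, p * Real.exp (ν * p - y * Real.cosh p) =
      ∫ p : ℝ, p * (Real.sinh (ν * p) * Real.exp (-(y * Real.cosh p))) := by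
  have h1 := integrable_mul_exp_mul_sub_cosh hy ν
  have h2 := integrable_mul_exp_mul_sub_cosh hy (-ν)
  have h3 : ∫ p : ℝ, p * Real.exp (-ν * p - y * Real.cosh p) =
      -∫ p : ℝ, p * Real.exp (ν * p - y * Real.cosh p) := by
    rw [← integral_neg_eq_self, ← integral_neg]
    simp
  have h4 : (fun p : ℝ => p * (Real.sinh (ν * p) * Real.exp (-(y * Real.cosh p)))) = fun p =>
      (1 / 2) * (p * Real.exp (ν * p - y * Real.cosh p) -
        p * Real.exp (-ν * p - y * Real.cosh p)) := by
    ext p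
    rw [Real.sinh_eq, sub_eq_add_neg (ν * p), sub_eq_add_neg (-ν * p), Real.exp_add,
      Real.exp_add, neg_mul]
    ring
  rw [h4]
  refine ⟨(h1.sub h2).const_mul _, ?_⟩
  rw [integral_const_mul, integral_sub h1 h2, h3]
  ring

theorem sinh_mul_integral_exp_eq {y : ℝ} (hy : 0 < y) (ν : ℝ) {q r : ℝ}
    (hr : Real.exp (2 * r) = 1 + Real.exp q) :
    Real.sinh (ν * r) * ∫ p : ℝ, Real.exp (ν * p - y * Real.exp r * Real.cosh p) =
      ∫ s : ℝ, Real.sinh (ν * s) * Real.exp (-(y * Real.cosh s)) *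
        Real.exp (-(y / 2 * Real.exp (q - s))) := by
  have hY : 0 < y * Real.exp r := by positivity
  have h1 := integrable_exp_mul_sub_cosh hY ν
  have h2 := integrable_exp_mul_sub_cosh hY (-ν)
  have h3 : ∫ p : ℝ, Real.exp (-ν * p - y * Real.exp r * Real.cosh p) =
      ∫ p : ℝ, Real.exp (ν * p - y * Real.exp r * Real.cosh p) := by
    rw [← integral_neg_eq_self]
    simp
  conv_rhs => rw [← integral_add_right_eq_self _ r]
  have h4 : ∀ p : ℝ, Real.sinh (ν * (p + r)) * Real.exp (-(y * Real.cosh (p + r))) *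
      Real.exp (-(y / 2 * Real.exp (q - (p + r)))) =
      (Real.exp (ν * r) / 2) * Real.exp (ν * p - y * Real.exp r * Real.cosh p) -
      (Real.exp (-(ν * r)) / 2) * Real.exp (-ν * p - y * Real.exp r * Real.cosh p) := fun p => by
    have e : -(y * Real.cosh (p + r)) + -(y / 2 * Real.exp (q - (p + r))) =
        -(y * Real.exp r * Real.cosh p) := by
      have hq : Real.exp q = Real.exp r * Real.exp r - 1 := by
        rw [← Real.exp_add, ← two_mul]; linarith
      have hr' : Real.exp (-r) * Real.exp r = 1 := by rw [← Real.exp_add]; simp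
      rw [Real.cosh_eq, Real.cosh_eq, sub_eq_add_neg, Real.exp_add q, hq, neg_add,
        Real.exp_add, Real.exp_add]
      linear_combination (-(y / 2) * Real.exp (-p) * Real.exp r) * hr'
    rw [mul_assoc, ← Real.exp_add, e, Real.sinh_eq, mul_add, neg_add, Real.exp_add, Real.exp_add,
      sub_eq_add_neg (ν * p), sub_eq_add_neg (-ν * p), Real.exp_add (ν * p),
      Real.exp_add (-ν * p), neg_mul]
    ring
  simp_rw [h4]
  rw [integral_sub (h1.const_mul _) (h2.const_mul _), integral_const_mul, integral_const_mul, h3,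
    Real.sinh_eq]
  ring

theorem two_mul_sinh_mul_integral_exp_eq {y : ℝ} (hy : 0 < y) (ν : ℝ) {q r : ℝ}
    (hr : Real.exp (2 * r) = 1 + Real.exp q) :
    2 * Real.sinh (ν * r) * ∫ p : ℝ, Real.exp (ν * p - y * Real.exp r * Real.cosh p) =
      ∫ s : ℝ, Real.sinh (ν * s) * Real.exp (-(y * Real.cosh s)) *
        (Real.exp (-(y / 2 * Real.exp (q - s))) - Real.exp (-(y / 2 * Real.exp (q + s)))) := by
  have hi : ∀ ε : ℝ, Integrable fun s : ℝ =>
      Real.sinh (ν * s) * Real.exp (-(y * Real.cosh s)) *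
        Real.exp (-(y / 2 * Real.exp (q + ε * s))) := fun ε => by
    refine (integrable_sinh_mul_exp_neg_cosh hy ν).mul_bdd (c := 1)
      (Continuous.aestronglyMeasurable (by fun_prop)) (ae_of_all _ fun s => ?_)
    rw [Real.norm_eq_abs, Real.abs_exp, Real.exp_le_one_iff]
    have := Real.exp_pos (q + ε * s)
    nlinarith
  have hm := hi (-1)
  have hp := hi 1
  simp only [neg_mul, one_mul, ← sub_eq_add_neg] at hm hp
  simp_rw [mul_sub]
  rw [integral_sub hm hp, mul_assoc, sinh_mul_integral_exp_eq hy ν hr, two_mul, sub_eq_add_neg]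
  congr 1
  rw [← integral_neg_eq_self, ← integral_neg]
  simp

/-- The order derivative of `K_ν(y)` as a superposition of the values `K_ν(y e^r)`, `r > 0`, with
a nonnegative weight; here `r` is parametrised by `e^{2r} = 1 + e^q`. -/
theorem integral_mul_exp_eq_integral_sinh_mul {y ν : ℝ} (hy : 0 < y) (hν : 0 ≤ ν) {r : ℝ → ℝ}
    (hr : ∀ q, Real.exp (2 * r q) = 1 + Real.exp q) :
    Integrable (fun q : ℝ => 2 * Real.sinh (ν * r q) *
      ∫ p : ℝ, Real.exp (ν * p - y * Real.exp (r q) * Real.cosh p)) ∧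
    ∫ p : ℝ, 2 * p * Real.exp (ν * p - y * Real.cosh p) =
      ∫ q : ℝ, 2 * Real.sinh (ν * r q) *
        ∫ p : ℝ, Real.exp (ν * p - y * Real.exp (r q) * Real.cosh p) := by
  have hy2 : 0 < y / 2 := by positivity
  set Ψ : ℝ → ℝ → ℝ := fun s q => Real.sinh (ν * s) * Real.exp (-(y * Real.cosh s)) *
        (Real.exp (-(y / 2 * Real.exp (q - s))) - Real.exp (-(y / 2 * Real.exp (q + s)))) with hΨ
  have hnn : ∀ s q, 0 ≤ Ψ s q := fun s q => by
    have h0 : 0 ≤ Real.sinh (ν * s) *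
        (Real.exp (-(y / 2 * Real.exp (q - s))) - Real.exp (-(y / 2 * Real.exp (q + s)))) := by
      rcases le_total 0 s with hs | hs
      · refine mul_nonneg (Real.sinh_nonneg_iff.2 (by positivity)) (sub_nonneg.2 ?_)
        gcongr; linarith
      · refine mul_nonneg_of_nonpos_of_nonpos
          (Real.sinh_nonpos_iff.2 (mul_nonpos_of_nonneg_of_nonpos hν hs)) (sub_nonpos.2 ?_)
        gcongr; linarith
    have := mul_nonneg h0 (Real.exp_pos (-(y * Real.cosh s))).le
    simp only [hΨ]
    linarith
  have hval : ∀ s, ∫ q, Ψ s q =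
      2 * (s * (Real.sinh (ν * s) * Real.exp (-(y * Real.cosh s)))) := fun s => by
    simp only [hΨ]
    rw [integral_const_mul, (frullani_exp_neg_exp hy2 s).2]
    ring
  obtain ⟨hi, heq⟩ := integral_mul_exp_eq_integral_mul_sinh hy ν
  have hint : Integrable (Function.uncurry Ψ) (volume.prod volume) := by
    rw [integrable_prod_iff (Continuous.aestronglyMeasurable (by simp only [hΨ]; fun_prop))]
    refine ⟨ae_of_all _ fun s => (frullani_exp_neg_exp hy2 s).1.const_mul
      (Real.sinh (ν * s) * Real.exp (-(y * Real.cosh s))), ?_⟩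
    simp only [Function.uncurry_apply_pair, Real.norm_eq_abs, abs_of_nonneg (hnn _ _), hval]
    exact hi.const_mul 2
  have hq : ∀ q, 2 * Real.sinh (ν * r q) *
      ∫ p : ℝ, Real.exp (ν * p - y * Real.exp (r q) * Real.cosh p) = ∫ s, Ψ s q := fun q =>
    two_mul_sinh_mul_integral_exp_eq hy ν (hr q)
  simp_rw [hq]
  refine ⟨hint.integral_prod_right, ?_⟩
  rw [← integral_integral_swap hint]
  simp_rw [hval, mul_assoc]
  rw [integral_const_mul, integral_const_mul, heq]

theorem cosh_add_add_cosh_sub (p t : ℝ) :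
    Real.cosh (p + t) + Real.cosh (p - t) = 2 * Real.cosh t * Real.cosh p := by
  rw [Real.cosh_add, Real.cosh_sub]; ring

theorem cexp_mul_cexp_add_sub (b σ x p t : ℝ) :
    Complex.exp ((σ + x * Complex.I) * (p + t : ℝ) - b * Real.cosh (p + t)) *
      Complex.exp ((σ - x * Complex.I) * (p - t : ℝ) - b * Real.cosh (p - t)) =
    Complex.exp (2 * x * t * Complex.I) *
      (Real.exp (2 * σ * p - 2 * b * Real.cosh t * Real.cosh p) : ℂ) := by
  have h := congrArg (fun z : ℝ => (z : ℂ)) (cosh_add_add_cosh_sub p t)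
  rw [Complex.ofReal_exp, ← Complex.exp_add, ← Complex.exp_add]
  push_cast at h ⊢
  congr 1
  linear_combination (-(b : ℂ)) * h

/-- Product formula for `K_{σ+ix}(b) K_{σ-ix}(b)`. -/
theorem coshLaplace_mul_coshLaplace {b : ℝ} (hb : 0 < b) (σ x : ℝ) :
    coshLaplace b (σ + x * Complex.I) * coshLaplace b (σ - x * Complex.I) =
      2 * ∫ t : ℝ, Complex.exp (2 * x * t * Complex.I) *
        ((∫ p : ℝ, Real.exp (2 * σ * p - 2 * b * Real.cosh t * Real.cosh p) : ℝ) : ℂ) := by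
  have hf := integrable_cexp_mul_sub_cosh hb (σ + x * Complex.I)
  have hg := integrable_cexp_mul_sub_cosh hb (σ - x * Complex.I)
  have h := integral_prod_eq_two_mul_integral_add_sub (F := fun u v =>
    Complex.exp ((σ + x * Complex.I) * u - b * Real.cosh u) *
      Complex.exp ((σ - x * Complex.I) * v - b * Real.cosh v)) (hf.mul_prod hg)
  simp_rw [integral_const_mul, integral_mul_const, cexp_mul_cexp_add_sub, integral_const_mul,
    integral_complex_ofReal] at h
  exact h

theorem hasDerivAt_coshLaplace_mul_coshLaplace {a : ℝ} (ha : 0 < a) (σ x : ℝ) :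
    HasDerivAt (fun σ : ℝ =>
      coshLaplace a (σ + x * Complex.I) * coshLaplace a (σ - x * Complex.I))
      (2 * ∫ t : ℝ, Complex.exp (2 * x * t * Complex.I) *
        ((∫ p : ℝ, 2 * p * Real.exp (2 * σ * p - 2 * a * Real.cosh t * Real.cosh p) : ℝ) : ℂ))
      σ := by
  obtain ⟨hf', hdf⟩ := hasDerivAt_coshLaplace ha (σ + x * Complex.I)
  obtain ⟨hg', hdg⟩ := hasDerivAt_coshLaplace ha (σ - x * Complex.I)
  have hf := integrable_cexp_mul_sub_cosh ha (σ + x * Complex.I)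
  have hg := integrable_cexp_mul_sub_cosh ha (σ - x * Complex.I)
  have hd : HasDerivAt (fun s : ℂ =>
      coshLaplace a (s + x * Complex.I) * coshLaplace a (s - x * Complex.I)) _ (σ : ℂ) :=
    (hdf.comp_add_const _ _).mul (hdg.comp_sub_const _ _)
  convert! hd.comp_ofReal using 1
  have h := integral_prod_eq_two_mul_integral_add_sub (F := fun u v =>
    ((u : ℂ) * Complex.exp ((σ + x * Complex.I) * u - a * Real.cosh u)) *
      Complex.exp ((σ - x * Complex.I) * v - a * Real.cosh v) +
    Complex.exp ((σ + x * Complex.I) * u - a * Real.cosh u) *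
      ((v : ℂ) * Complex.exp ((σ - x * Complex.I) * v - a * Real.cosh v)))
      ((hf'.mul_prod hg).add (hf.mul_prod hg'))
  have h1 : ∀ u : ℝ, ∫ v : ℝ,
      (((u : ℂ) * Complex.exp ((σ + x * Complex.I) * u - a * Real.cosh u)) *
        Complex.exp ((σ - x * Complex.I) * v - a * Real.cosh v) +
      Complex.exp ((σ + x * Complex.I) * u - a * Real.cosh u) *
        ((v : ℂ) * Complex.exp ((σ - x * Complex.I) * v - a * Real.cosh v))) =
      ((u : ℂ) * Complex.exp ((σ + x * Complex.I) * u - a * Real.cosh u)) *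
        coshLaplace a (σ - x * Complex.I) +
      Complex.exp ((σ + x * Complex.I) * u - a * Real.cosh u) *
        ∫ v : ℝ, ((v : ℂ) * Complex.exp ((σ - x * Complex.I) * v - a * Real.cosh v)) := fun u => by
    rw [integral_add (hg.const_mul _) (hg'.const_mul _), integral_const_mul, integral_const_mul]
    rfl
  simp_rw [h1] at h
  rw [integral_add (hf'.mul_const _) (hf.mul_const _), integral_mul_const,
    integral_mul_const] at h
  refine Eq.trans ?_ h.symm
  congr 2 with t
  rw [← integral_complex_ofReal, ← integral_const_mul]
  congr 1 with p
  have h2 := cexp_mul_cexp_add_sub a σ x p t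
  push_cast at h2 ⊢
  linear_combination (-2 * (p : ℂ)) * h2

theorem integrable_integral_mul_exp {a : ℝ} (ha : 0 < a) (σ : ℝ) :
    Integrable fun t : ℝ =>
      ∫ p : ℝ, 2 * p * Real.exp (2 * σ * p - 2 * a * Real.cosh t * Real.cosh p) := by
  have hb := (integrable_exp_mul_sub_cosh ha 0).mul_prod
    ((integrable_mul_exp_mul_sub_cosh ha (2 * σ)).norm.const_mul 2)
  have hi : Integrable (Function.uncurry fun t p : ℝ =>
      2 * p * Real.exp (2 * σ * p - 2 * a * Real.cosh t * Real.cosh p))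
      (volume.prod volume) := by
    refine hb.mono' (Continuous.aestronglyMeasurable (by fun_prop)) (ae_of_all _ ?_)
    rintro ⟨t, p⟩
    simp only [Function.uncurry_apply_pair, norm_mul, Real.norm_eq_abs, Real.abs_exp, abs_two]
    have h1 : Real.exp (2 * σ * p - 2 * a * Real.cosh t * Real.cosh p) ≤
        Real.exp (0 * t - a * Real.cosh t) * Real.exp (2 * σ * p - a * Real.cosh p) := by
      rw [← Real.exp_add]
      refine Real.exp_le_exp.2 ?_
      have := Real.one_le_cosh t
      have := Real.one_le_cosh p
      have : 0 ≤ a * (Real.cosh t * (Real.cosh p - 1) + Real.cosh p * (Real.cosh t - 1)) := by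
        apply mul_nonneg ha.le
        apply add_nonneg <;> apply mul_nonneg <;> linarith
      linarith
    have := mul_le_mul_of_nonneg_left h1 (by positivity : 0 ≤ 2 * |p|)
    linarith
  exact hi.integral_prod_left

theorem exists_nonneg_deriv_normSq_coshLaplace {a σ : ℝ} (ha : 0 < a) (hσ : 0 ≤ σ) (x : ℝ) :
    ∃ D : ℝ, 0 ≤ D ∧
      HasDerivAt (fun σ : ℝ => Complex.normSq (coshLaplace a (σ + x * Complex.I))) D σ := by
  set r : ℝ → ℝ := fun q => Real.log (1 + Real.exp q) / 2 with hr
  have hrexp : ∀ q, Real.exp (2 * r q) = 1 + Real.exp q := fun q => by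
    rw [hr, mul_div_cancel₀ _ two_ne_zero, Real.exp_log (by positivity)]
  have hr0 : ∀ q, 0 ≤ r q := fun q =>
    div_nonneg (Real.log_nonneg (by linarith [Real.exp_pos q])) two_pos.le
  have hrc : Continuous r := by
    refine (Continuous.log (by fun_prop) fun q => ?_).div_const 2
    positivity
  have hsinh : ∀ q, 0 ≤ 2 * Real.sinh (2 * σ * r q) := fun q =>
    mul_nonneg two_pos.le (Real.sinh_nonneg_iff.2 (by have := hr0 q; positivity))
  set G : ℝ → ℝ → ℝ := fun t q => 2 * Real.sinh (2 * σ * r q) *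
    ∫ p : ℝ, Real.exp (2 * σ * p - 2 * a * Real.cosh t * Real.exp (r q) * Real.cosh p) with hG
  have hy : ∀ t, 0 < 2 * a * Real.cosh t := fun t => by positivity
  have hgt : ∀ t, Integrable (G t) ∧
      ∫ p : ℝ, 2 * p * Real.exp (2 * σ * p - 2 * a * Real.cosh t * Real.cosh p) =
        ∫ q, G t q := fun t => integral_mul_exp_eq_integral_sinh_mul (hy t)
    (by positivity : 0 ≤ 2 * σ) hrexp
  have hGnn : ∀ t q, 0 ≤ G t q := fun t q =>
    mul_nonneg (hsinh q) (integral_nonneg fun p => (Real.exp_pos _).le)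
  have hGm : StronglyMeasurable (Function.uncurry G) := by
    refine StronglyMeasurable.mul (f := fun z : ℝ × ℝ => 2 * Real.sinh (2 * σ * r z.2))
      (Continuous.stronglyMeasurable (by fun_prop)) ?_
    refine StronglyMeasurable.integral_prod_right (f := fun z : (ℝ × ℝ) => fun p : ℝ =>
      Real.exp (2 * σ * p - 2 * a * Real.cosh z.1 * Real.exp (r z.2) * Real.cosh p)) ?_
    exact Continuous.stronglyMeasurable (by fun_prop)
  have hint : Integrable (Function.uncurry fun t q : ℝ =>
      Complex.exp (2 * x * t * Complex.I) * (G t q : ℂ)) (volume.prod volume) := by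
    have hn : ∀ t : ℝ, ‖Complex.exp (2 * x * t * Complex.I)‖ = 1 := fun t => by
      have := Complex.norm_exp_ofReal_mul_I (2 * x * t)
      push_cast at this
      exact this
    rw [integrable_prod_iff]
    · refine ⟨ae_of_all _ fun t => ((hgt t).1.ofReal (𝕜 := ℂ)).const_mul
        (Complex.exp (2 * x * t * Complex.I)), ?_⟩
      simp only [Function.uncurry_apply_pair, norm_mul, hn, one_mul, Complex.norm_real,
        Real.norm_eq_abs, abs_of_nonneg (hGnn _ _)]
      refine (integrable_integral_mul_exp ha σ).congr (ae_of_all _ fun t => (hgt t).2)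
    · refine StronglyMeasurable.aestronglyMeasurable ?_
      refine StronglyMeasurable.mul (f := fun z : ℝ × ℝ => Complex.exp (2 * x * z.1 * Complex.I))
        (Continuous.stronglyMeasurable (by fun_prop)) ?_
      exact Complex.continuous_ofReal.comp_stronglyMeasurable hGm
  have hD := hasDerivAt_coshLaplace_mul_coshLaplace ha σ x
  have hDval : (2 * ∫ t : ℝ, Complex.exp (2 * x * t * Complex.I) *
        ((∫ p : ℝ, 2 * p * Real.exp (2 * σ * p - 2 * a * Real.cosh t * Real.cosh p) : ℝ) : ℂ)) =
      ((∫ q : ℝ, 2 * Real.sinh (2 * σ * r q) *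
        Complex.normSq (coshLaplace (a * Real.exp (r q)) (σ + x * Complex.I)) : ℝ) : ℂ) := by
    have hA : ∀ t : ℝ, Complex.exp (2 * x * t * Complex.I) *
        ((∫ p : ℝ, 2 * p * Real.exp (2 * σ * p - 2 * a * Real.cosh t * Real.cosh p) : ℝ) : ℂ) =
        ∫ q, Complex.exp (2 * x * t * Complex.I) * (G t q : ℂ) := fun t => by
      rw [(hgt t).2, ← integral_complex_ofReal, ← integral_const_mul]
    simp_rw [hA]
    rw [integral_integral_swap hint, ← integral_complex_ofReal, ← integral_const_mul]
    congr 1 with q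
    rw [Complex.ofReal_mul, ← coshLaplace_mul_conj_symm,
      coshLaplace_mul_coshLaplace (by positivity), mul_left_comm]
    congr 1
    rw [← integral_const_mul]
    congr 1 with t
    simp only [hG]
    rw [Complex.ofReal_mul, mul_left_comm]
    congr 6 with p
    ring_nf
  refine ⟨∫ q : ℝ, 2 * Real.sinh (2 * σ * r q) *
    Complex.normSq (coshLaplace (a * Real.exp (r q)) (σ + x * Complex.I)),
    integral_nonneg fun q => mul_nonneg (hsinh q) (Complex.normSq_nonneg _), ?_⟩
  rw [hDval] at hD
  simp_rw [coshLaplace_mul_conj_symm] at hD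
  exact Complex.reCLM.hasFDerivAt.comp_hasDerivAt σ hD

theorem monotoneOn_normSq_coshLaplace {a : ℝ} (ha : 0 < a) (x : ℝ) :
    MonotoneOn (fun σ : ℝ => Complex.normSq (coshLaplace a (σ + x * Complex.I))) (Ici 0) := by
  choose! D hD0 hD using fun σ (hσ : (0 : ℝ) ≤ σ) =>
    exists_nonneg_deriv_normSq_coshLaplace ha hσ x
  refine monotoneOn_of_deriv_nonneg (convex_Ici 0)
    (fun σ hσ => (hD σ hσ).continuousAt.continuousWithinAt)
    (fun σ hσ => (hD σ (interior_subset hσ)).differentiableAt.differentiableWithinAt)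
    (fun σ hσ => ?_)
  rw [(hD σ (interior_subset hσ)).deriv]
  exact hD0 σ (interior_subset hσ)

theorem normSq_coshLaplace_abs (a σ x : ℝ) :
    Complex.normSq (coshLaplace a ((|σ| : ℝ) + x * Complex.I)) =
      Complex.normSq (coshLaplace a (σ + x * Complex.I)) := by
  rcases abs_choice σ with h | h
  · rw [h]
  · rw [h, ← Complex.normSq_conj, ← coshLaplace_conj, ← coshLaplace_neg]
    congr 2
    simp [add_comm]

theorem coshLaplace_zero_ne_zero {a : ℝ} (ha : 0 < a) : coshLaplace a 0 ≠ 0 := by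
  have h : coshLaplace a 0 = ((∫ u : ℝ, Real.exp (0 * u - a * Real.cosh u) : ℝ) : ℂ) := by
    rw [← integral_complex_ofReal, coshLaplace]
    congr 1 with u
    push_cast
    simp
  rw [h, Complex.ofReal_ne_zero]
  exact (integral_exp_pos (integrable_exp_mul_sub_cosh ha 0)).ne'

theorem eq_of_eqOn_Ioo_ofReal {f g : ℂ → ℂ} (hf : Differentiable ℂ f) (hg : Differentiable ℂ g)
    {α β : ℝ} (hαβ : α < β) (h : ∀ s ∈ Ioo α β, f (s : ℝ) = g (s : ℝ)) : f = g := by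
  obtain ⟨m, hm⟩ := nonempty_Ioo.2 hαβ
  refine AnalyticOnNhd.eq_of_frequently_eq (z₀ := (m : ℂ))
    (fun z _ => hf.analyticAt z) (fun z _ => hg.analyticAt z) ?_
  have h1 : Tendsto (fun s : ℝ => (s : ℂ)) (𝓝[≠] m) (𝓝[≠] (m : ℂ)) :=
    tendsto_nhdsWithin_of_tendsto_nhds_of_eventually_within _
      (Complex.continuous_ofReal.continuousAt.tendsto.mono_left nhdsWithin_le_nhds)
      (eventually_nhdsWithin_of_forall fun s hs => by simpa using hs)
  refine h1.frequently (Eventually.frequently ?_)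
  filter_upwards [nhdsWithin_le_nhds (Ioo_mem_nhds hm.1 hm.2)] with s hs using h s hs

theorem strictMonoOn_normSq_coshLaplace {a : ℝ} (ha : 0 < a) (x : ℝ) :
    StrictMonoOn (fun σ : ℝ => Complex.normSq (coshLaplace a (σ + x * Complex.I))) (Ici 0) := by
  have hmono := monotoneOn_normSq_coshLaplace ha x
  intro α hα β hβ hαβ
  refine lt_of_le_of_ne (hmono hα hβ hαβ.le) fun heq => ?_
  simp only at heq
  have hdiff := differentiable_coshLaplace ha
  set C : ℂ := (Complex.normSq (coshLaplace a (α + x * Complex.I)) : ℂ) with hC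
  have hconst : (fun s : ℂ => coshLaplace a (s + x * Complex.I) *
      coshLaplace a (s - x * Complex.I)) = fun _ => C := by
    refine eq_of_eqOn_Ioo_ofReal ((hdiff.comp (by fun_prop)).mul (hdiff.comp (by fun_prop)))
      (differentiable_const C) hαβ fun s hs => ?_
    have hs0 : s ∈ Ici (0 : ℝ) := le_trans hα hs.1.le
    have h1 := hmono hα hs0 hs.1.le
    have h2 := hmono hs0 hβ hs.2.le
    simp only at h1 h2
    rw [coshLaplace_mul_conj_symm, hC, le_antisymm h1 (heq ▸ h2)]
  have hC0 : C = 0 := by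
    have hlim : ∀ y : ℝ, Tendsto (fun ξ : ℝ => coshLaplace a (ξ * Complex.I + y * Complex.I))
        atTop (𝓝 0) := fun y => by
      refine ((tendsto_coshLaplace_I_mul a).comp
        (tendsto_atTop_add_const_right _ y tendsto_id)).congr fun ξ => ?_
      simp [add_mul]
    have h3 := (hlim x).mul (hlim (-x))
    rw [mul_zero] at h3
    refine tendsto_nhds_unique (tendsto_const_nhds.congr fun ξ : ℝ => ?_) h3
    rw [← congrFun hconst (ξ * Complex.I)]
    simp [sub_eq_add_neg]
  have hzero : (fun s : ℂ => coshLaplace a (s + x * Complex.I)) = fun _ => 0 := by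
    refine eq_of_eqOn_Ioo_ofReal (hdiff.comp (by fun_prop)) (differentiable_const 0) hαβ
      fun s _ => ?_
    have h4 := congrFun hconst (s : ℂ)
    simp only [coshLaplace_mul_conj_symm, hC0] at h4
    exact Complex.normSq_eq_zero.1 (by exact_mod_cast h4)
  refine coshLaplace_zero_ne_zero ha ?_
  simpa using congrFun hzero (-(x * Complex.I))

/-- for `a > 0` and `c > 0`, `F_{a,c}` has only real zeros. -/
theorem Fac_zeros_real (a c : ℝ) (ha : 0 < a) (hc : 0 < c) (z : ℂ) (hz : Fac a c z = 0) :
    z.im = 0 := by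
  have h0 : coshLaplace a ((-z.im + c : ℝ) + z.re * Complex.I) +
      coshLaplace a ((-z.im - c : ℝ) + z.re * Complex.I) = 0 := by
    have e1 : ((-z.im + c : ℝ) + z.re * Complex.I : ℂ) = Complex.I * (z - Complex.I * c) := by
      apply Complex.ext <;> simp [neg_add_eq_sub]
    have e2 : ((-z.im - c : ℝ) + z.re * Complex.I : ℂ) = Complex.I * (z + Complex.I * c) := by
      apply Complex.ext <;> simp [neg_add_eq_sub]
    rw [e1, e2, ← Kbes_eq_coshLaplace ha, ← Kbes_eq_coshLaplace ha, ← mul_add]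
    exact mul_eq_zero_of_right 2 hz
  have h1 : Complex.normSq (coshLaplace a ((|-z.im + c| : ℝ) + z.re * Complex.I)) =
      Complex.normSq (coshLaplace a ((|-z.im - c| : ℝ) + z.re * Complex.I)) := by
    rw [normSq_coshLaplace_abs, normSq_coshLaplace_abs, eq_neg_of_add_eq_zero_left h0,
      Complex.normSq_neg]
  have h2 := (strictMonoOn_normSq_coshLaplace ha z.re).injOn
    (mem_Ici.2 (abs_nonneg _)) (mem_Ici.2 (abs_nonneg _)) h1
  rcases abs_eq_abs.1 h2 with h | h <;> linarith
end
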